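/- Let d ≥ 2 and let Ω₁ ⊆ Ω₂ ⊂ ℝ^d be nonempty bounded convex open sets. Then μ₁(Ω₁) ≥ (π²/(2d(d+4)))·μ₁(Ω₂). -/

import Mathlib

open MeasureTheory Real Filter

noncomputable section

/-- Euclidean space `ℝ^d`. -/
abbrev Euc (d : ℕ) := EuclideanSpace ℝ (Fin d)

/-- The Rayleigh quotient of a function `u` on a set `Ω ⊆ ℝ^d`. -/
noncomputable def rayleigh {d : ℕ} (Ω : Set (Euc d)) (u : Euc d → ℝ) : ℝ :=
  (∫ x in Ω, ‖fderiv ℝ u x‖ ^ 2) / (∫ x in Ω, (u x) ^ 2)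

/-- The `k`-th Neumann eigenvalue of `Ω ⊆ ℝ^d`, defined by the variational (min-max)
principle: the infimum, over all subspaces `V` of smooth functions `ℝ^d → ℝ` whose space of
restrictions to `Ω` is `(k+1)`-dimensional, of the supremum of the Rayleigh quotient over
the elements of `V` that are nonzero in `L²(Ω)`. -/
noncomputable def neumannEigenvalue {d : ℕ} (k : ℕ) (Ω : Set (Euc d)) : ℝ :=
  sInf { t : ℝ | ∃ V : Submodule ℝ (Euc d → ℝ),
    (∀ u ∈ V, ContDiff ℝ (⊤ : ℕ∞) u) ∧
    Module.finrank ℝ (V.map (LinearMap.funLeft ℝ ℝ ((↑) : Ω → Euc d))) = k + 1 ∧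
    t = sSup { r : ℝ | ∃ u ∈ V, (0 < ∫ x in Ω, (u x) ^ 2) ∧ r = rayleigh Ω u } }

/-- A nonempty bounded convex open subset of `ℝ^d`. -/
def IsConvexDomain {d : ℕ} (Ω : Set (Euc d)) : Prop :=
  Ω.Nonempty ∧ IsOpen Ω ∧ Bornology.IsBounded Ω ∧ Convex ℝ Ω

/-- The optimal constant `α_{k,d}`: the infimum of `μ_k(Ω₁)/μ_k(Ω₂)` over all pairs of
nonempty bounded convex open sets `Ω₁ ⊆ Ω₂ ⊂ ℝ^d`. -/
noncomputable def alphaConst (k d : ℕ) : ℝ :=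
  sInf { r : ℝ | ∃ Ω₁ Ω₂ : Set (Euc d), IsConvexDomain Ω₁ ∧ IsConvexDomain Ω₂ ∧ Ω₁ ⊆ Ω₂ ∧
    r = neumannEigenvalue k Ω₁ / neumannEigenvalue k Ω₂ }

/-- The Bessel function of the first kind of order `ν` (for `x > 0`). -/
noncomputable def besselJ (ν : ℝ) (x : ℝ) : ℝ :=
  ∑' m : ℕ, ((-1 : ℝ) ^ m / (m.factorial * Real.Gamma (m + ν + 1))) * (x / 2) ^ (2 * (m : ℝ) + ν)

/-- The first positive zero `j_{ν,1}` of the Bessel function `J_ν`. -/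
noncomputable def besselZero1 (ν : ℝ) : ℝ :=
  sInf {x : ℝ | 0 < x ∧ besselJ ν x = 0}

/-- The second positive zero `j_{ν,2}` of the Bessel function `J_ν`. -/
noncomputable def besselZero2 (ν : ℝ) : ℝ :=
  sInf {x : ℝ | besselZero1 ν < x ∧ besselJ ν x = 0}

section Part1

open scoped ENNReal Pointwise

lemma bm_compact {A B : Set ℝ} (hA : IsCompact A) (hB : IsCompact B) (hAn : A.Nonempty)
    (hBn : B.Nonempty) : volume A + volume B ≤ volume (A + B) := by
  obtain ⟨a, haA, ha⟩ := hA.exists_isGreatest hAn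
  obtain ⟨b, hbB, hb⟩ := hB.exists_isLeast hBn
  have h1 : (fun x => x + b) '' A ∪ (fun x => a + x) '' B ⊆ A + B := by
    rintro x (⟨y, hy, rfl⟩ | ⟨y, hy, rfl⟩)
    · exact Set.add_mem_add hy hbB
    · exact Set.add_mem_add haA hy
  have hd : AEDisjoint volume ((fun x => x + b) '' A) ((fun x => a + x) '' B) := by
    have : ((fun x => x + b) '' A) ∩ ((fun x => a + x) '' B) ⊆ {a + b} := by
      rintro x ⟨⟨y, hy, rfl⟩, ⟨z, hz, h⟩⟩
      have := ha hy
      have := hb hz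
      simp only [Set.mem_singleton_iff] at *
      linarith
    exact measure_mono_null this (by simp)
  have hm : MeasurableSet ((fun x => a + x) '' B) :=
    (hB.image (by fun_prop)).measurableSet
  calc volume A + volume B = volume ((fun x => x + b) '' A) + volume ((fun x => a + x) '' B) := by
        simp [measure_preimage_add, measure_preimage_add_right]
    _ = volume ((fun x => x + b) '' A ∪ (fun x => a + x) '' B) := by
        rw [measure_union₀ hm.nullMeasurableSet hd]
    _ ≤ _ := measure_mono h1

lemma bm_meas {A B : Set ℝ} (hA : MeasurableSet A) (hB : MeasurableSet B) (hAn : A.Nonempty)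
    (hBn : B.Nonempty) : volume A + volume B ≤ volume (A + B) := by
  obtain ⟨a0, ha0⟩ := hAn
  obtain ⟨b0, hb0⟩ := hBn
  rw [hA.measure_eq_iSup_isCompact, hB.measure_eq_iSup_isCompact]
  simp only [iSup_and']
  refine ENNReal.biSup_add_biSup_le' (p := fun K => K ⊆ A ∧ IsCompact K) (q := fun K => K ⊆ B ∧ IsCompact K) ⟨∅, by simp⟩ ⟨∅, by simp⟩ ?_
  rintro K ⟨hK, hKc⟩ L ⟨hL, hLc⟩
  have h := bm_compact (hKc.insert a0) (hLc.insert b0) ⟨a0, by simp⟩ ⟨b0, by simp⟩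
  calc volume K + volume L ≤ volume (insert a0 K) + volume (insert b0 L) := by
        gcongr <;> exact Set.subset_insert _ _
    _ ≤ _ := h
    _ ≤ _ := measure_mono (Set.add_subset_add (Set.insert_subset ha0 hK) (Set.insert_subset hb0 hL))

lemma ennreal_amgm (a b : ℝ≥0∞) {l : ℝ} (h0 : 0 < l) (h1 : l < 1) :
    a ^ (1 - l) * b ^ l ≤ ENNReal.ofReal (1 - l) * a + ENNReal.ofReal l * b := by
  have hpq : (1 / (1 - l)).HolderConjugate (1 / l) := by
    rw [Real.holderConjugate_iff]
    constructor
    · rw [lt_div_iff₀] <;> linarith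
    · simp
  have := ENNReal.young_inequality (a ^ (1 - l)) (b ^ l) hpq
  rw [← ENNReal.rpow_mul, ← ENNReal.rpow_mul, mul_one_div_cancel (by linarith), mul_one_div_cancel h0.ne',
    ENNReal.rpow_one, ENNReal.rpow_one] at this
  refine this.trans (le_of_eq ?_)
  rw [ENNReal.div_eq_inv_mul, ENNReal.div_eq_inv_mul, ← ENNReal.ofReal_inv_of_pos (by apply one_div_pos.2; linarith),
    ← ENNReal.ofReal_inv_of_pos (by apply one_div_pos.2; linarith)]
  simp

/-- normalized one-dimensional Prékopa–Leindler with sup equal to one -/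
lemma pl_one_norm {f g h : ℝ → ℝ≥0∞} (hf : Measurable f) (hg : Measurable g)
    (hh : Measurable h) {l : ℝ} (h0 : 0 < l) (h1 : l < 1)
    (hyp : ∀ x y, f x ^ (1 - l) * g y ^ l ≤ h ((1 - l) * x + l * y))
    (hf1 : ⨆ x, f x = 1) (hg1 : ⨆ x, g x = 1) :
    (∫⁻ x, f x) ^ (1 - l) * (∫⁻ x, g x) ^ l ≤ ∫⁻ x, h x := by
  have hl : 0 < 1 - l := by linarith
  have hfle : ∀ x, f x ≤ 1 := fun x => hf1 ▸ le_iSup f x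
  have hgle : ∀ x, g x ≤ 1 := fun x => hg1 ▸ le_iSup g x
  have key : ∀ t : ℝ, 0 < t → t < 1 → ENNReal.ofReal (1 - l) * volume {x | ENNReal.ofReal t < f x}
      + ENNReal.ofReal l * volume {x | ENNReal.ofReal t < g x} ≤ volume {x | ENNReal.ofReal t < min (h x) 1} := by
    intro t ht0 ht1
    have ht1' : ENNReal.ofReal t < 1 := by simpa using (ENNReal.ofReal_lt_ofReal_iff one_pos).2 ht1
    set A := {x | ENNReal.ofReal t < f x}
    set B := {x | ENNReal.ofReal t < g x}
    have hA : MeasurableSet A := measurableSet_lt measurable_const hf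
    have hB : MeasurableSet B := measurableSet_lt measurable_const hg
    have hAn : A.Nonempty := by
      obtain ⟨x, hx⟩ := lt_iSup_iff.1 (hf1.symm ▸ ht1' : ENNReal.ofReal t < ⨆ x, f x)
      exact ⟨x, hx⟩
    have hBn : B.Nonempty := by
      obtain ⟨x, hx⟩ := lt_iSup_iff.1 (hg1.symm ▸ ht1' : ENNReal.ofReal t < ⨆ x, g x)
      exact ⟨x, hx⟩
    have hA' : volume ((1 - l) • A) = ENNReal.ofReal (1 - l) * volume A := by
      rw [Measure.addHaar_smul]; simp [abs_of_pos hl]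
    have hB' : volume (l • B) = ENNReal.ofReal l * volume B := by
      rw [Measure.addHaar_smul]; simp [abs_of_pos h0]
    rw [← hA', ← hB']
    refine (bm_meas (hA.const_smul₀ _) (hB.const_smul₀ _) hAn.smul_set hBn.smul_set).trans
      (measure_mono ?_)
    rintro z ⟨_, ⟨x, hx, rfl⟩, _, ⟨y, hy, rfl⟩, rfl⟩
    simp only [Set.mem_ofPred_eq, lt_min_iff, smul_eq_mul, ht1', and_true]
    refine lt_of_lt_of_le ?_ (hyp x y)
    have : ENNReal.ofReal t = ENNReal.ofReal t ^ (1 - l) * ENNReal.ofReal t ^ l := by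
      rw [← ENNReal.rpow_add _ _ (by simpa using ht0) (by simp)]; simp
    rw [this]
    exact ENNReal.mul_lt_mul (ENNReal.rpow_lt_rpow hx hl) (ENNReal.rpow_lt_rpow hy h0)
  have lay : ∀ k : ℝ → ℝ≥0∞, Measurable k → (∀ x, k x ≤ 1) →
      ∫⁻ x, k x = ∫⁻ t in Set.Ioo (0:ℝ) 1, volume {x | ENNReal.ofReal t < k x} := by
    intro k hk hk1
    have e1 : ∫⁻ x, k x = ∫⁻ x, ENNReal.ofReal (k x).toReal := by
      refine lintegral_congr fun x => ?_
      rw [ENNReal.ofReal_toReal (ne_top_of_le_ne_top ENNReal.one_ne_top (hk1 x))]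
    rw [e1, lintegral_eq_lintegral_meas_lt volume (Eventually.of_forall fun x => ENNReal.toReal_nonneg)
      hk.ennreal_toReal.aemeasurable]
    have e2 : ∀ t : ℝ, 0 < t → {x | t < (k x).toReal} = {x | ENNReal.ofReal t < k x} := by
      intro t ht
      ext x
      simp only [Set.mem_ofPred_eq]
      rw [ENNReal.ofReal_lt_iff_lt_toReal ht.le (ne_top_of_le_ne_top ENNReal.one_ne_top (hk1 x))]
    rw [← Set.Ioo_union_Ici_eq_Ioi (zero_lt_one' ℝ), lintegral_union measurableSet_Ici]
    · have : ∫⁻ t in Set.Ici (1:ℝ), volume {x | t < (k x).toReal} = 0 := by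
        rw [setLIntegral_congr_fun measurableSet_Ici (g := fun _ => 0)]
        · simp
        · intro t ht
          have : {x | t < (k x).toReal} = ∅ := by
            ext x
            have : (k x).toReal ≤ 1 := ENNReal.toReal_le_of_le_ofReal zero_le_one (by simpa using hk1 x)
            simp only [Set.mem_ofPred_eq, Set.mem_empty_iff_false, iff_false, not_lt]
            exact this.trans ht
          simp [this]
      rw [this, add_zero]
      exact setLIntegral_congr_fun measurableSet_Ioo fun t ht => by simp only [e2 t ht.1]
    · exact Set.disjoint_left.2 fun x hx hx' => absurd hx.2 (not_lt.2 hx')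
  refine (ennreal_amgm _ _ h0 h1).trans ?_
  refine le_trans ?_ (lintegral_mono (fun x => min_le_left (h x) 1))
  rw [lay f hf hfle, lay g hg hgle, lay _ (hh.min measurable_const) (fun x => min_le_right _ _)]
  have mono : ∀ k : ℝ → ℝ≥0∞, Measurable fun t : ℝ => volume {x | ENNReal.ofReal t < k x} := by
    intro k
    apply Antitone.measurable
    intro s t hst
    exact measure_mono fun x hx => lt_of_le_of_lt (ENNReal.ofReal_le_ofReal hst) hx
  rw [← lintegral_const_mul _ (mono f), ← lintegral_const_mul _ (mono g),
    ← lintegral_add_left ((mono f).const_mul _)]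
  exact setLIntegral_mono (mono _) fun t ht => key t ht.1 ht.2

lemma pl_one_bdd {f g h : ℝ → ℝ≥0∞} (hf : Measurable f) (hg : Measurable g)
    (hh : Measurable h) {l : ℝ} (h0 : 0 < l) (h1 : l < 1)
    (hyp : ∀ x y, f x ^ (1 - l) * g y ^ l ≤ h ((1 - l) * x + l * y))
    (hf1 : ⨆ x, f x ≠ ∞) (hg1 : ⨆ x, g x ≠ ∞) :
    (∫⁻ x, f x) ^ (1 - l) * (∫⁻ x, g x) ^ l ≤ ∫⁻ x, h x := by
  have hl : 0 < 1 - l := by linarith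
  set F := ⨆ x, f x with hF
  set G := ⨆ x, g x with hG
  by_cases hF0 : F = 0
  · have : ∀ x, f x = 0 := by simpa [hF] using hF0
    simp [this, hl]
  by_cases hG0 : G = 0
  · have : ∀ x, g x = 0 := by simpa [hG] using hG0
    simp [this, h0]
  have hFi : F⁻¹ ≠ ∞ := by simpa using hF0
  have hGi : G⁻¹ ≠ ∞ := by simpa using hG0
  have hc : (F ^ (1 - l) * G ^ l) ≠ 0 := by
    simp [hF0, hG0, hf1, hg1]
  have hc' : (F ^ (1 - l) * G ^ l) ≠ ∞ := by
    apply ENNReal.mul_ne_top <;> apply ENNReal.rpow_ne_top_of_nonneg <;> first | linarith | assumption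
  have key := pl_one_norm (f := fun x => F⁻¹ * f x) (g := fun x => G⁻¹ * g x)
    (h := fun x => (F ^ (1 - l) * G ^ l)⁻¹ * h x) (hf.const_mul _) (hg.const_mul _) (hh.const_mul _) h0 h1
    (by
      intro x y
      rw [ENNReal.mul_rpow_of_nonneg _ _ hl.le, ENNReal.mul_rpow_of_nonneg _ _ h0.le,
        ENNReal.inv_rpow, ENNReal.inv_rpow, mul_mul_mul_comm,
        ENNReal.mul_inv (Or.inr (ENNReal.rpow_ne_top_of_nonneg h0.le hg1)) (Or.inl (ENNReal.rpow_ne_top_of_nonneg hl.le hf1))]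
      gcongr
      exact hyp x y)
    (by rw [← ENNReal.mul_iSup, ← hF, ENNReal.inv_mul_cancel hF0 hf1])
    (by rw [← ENNReal.mul_iSup, ← hG, ENNReal.inv_mul_cancel hG0 hg1])
  rw [lintegral_const_mul _ hf, lintegral_const_mul _ hg, lintegral_const_mul _ hh,
    ENNReal.mul_rpow_of_nonneg _ _ hl.le, ENNReal.mul_rpow_of_nonneg _ _ h0.le,
        ENNReal.inv_rpow, ENNReal.inv_rpow, mul_mul_mul_comm,
        ← ENNReal.mul_inv (Or.inr (ENNReal.rpow_ne_top_of_nonneg h0.le hg1)) (Or.inl (ENNReal.rpow_ne_top_of_nonneg hl.le hf1))] at key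
  have := mul_le_mul_right key (F ^ (1 - l) * G ^ l)
  rwa [← mul_assoc, ENNReal.mul_inv_cancel hc hc', one_mul, ← mul_assoc, ENNReal.mul_inv_cancel hc hc', one_mul] at this

lemma lintegral_trunc {f : ℝ → ℝ≥0∞} (hf : Measurable f) :
    Tendsto (fun n : ℕ => ∫⁻ x, min (f x) n) atTop (nhds (∫⁻ x, f x)) := by
  apply lintegral_tendsto_of_tendsto_of_monotone
  · exact fun n => (hf.min measurable_const).aemeasurable
  · exact Eventually.of_forall fun x m n hmn => min_le_min le_rfl (by exact_mod_cast hmn)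
  · refine Eventually.of_forall fun x => ?_
    have := (tendsto_const_nhds (x := f x) (f := (atTop : Filter ℕ))).min ENNReal.tendsto_nat_nhds_top
    simpa using this

lemma pl_one {f g h : ℝ → ℝ≥0∞} (hf : Measurable f) (hg : Measurable g)
    (hh : Measurable h) {l : ℝ} (h0 : 0 < l) (h1 : l < 1)
    (hyp : ∀ x y, f x ^ (1 - l) * g y ^ l ≤ h ((1 - l) * x + l * y)) :
    (∫⁻ x, f x) ^ (1 - l) * (∫⁻ x, g x) ^ l ≤ ∫⁻ x, h x := by
  have hl : 0 < 1 - l := by linarith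
  have key : ∀ n m : ℕ, (∫⁻ x, min (f x) n) ^ (1 - l) * (∫⁻ x, min (g x) m) ^ l ≤ ∫⁻ x, h x := by
    intro n m
    refine pl_one_bdd (hf.min measurable_const) (hg.min measurable_const) hh h0 h1 ?_ ?_ ?_
    · intro x y
      refine le_trans ?_ (hyp x y)
      gcongr <;> exact min_le_left _ _
    · exact ne_top_of_le_ne_top (ENNReal.natCast_ne_top n) (iSup_le fun x => min_le_right _ _)
    · exact ne_top_of_le_ne_top (ENNReal.natCast_ne_top m) (iSup_le fun x => min_le_right _ _)
  have hfe : ∫⁻ x, f x = ⨆ n : ℕ, ∫⁻ x, min (f x) n :=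
    tendsto_nhds_unique (lintegral_trunc hf) (tendsto_atTop_iSup fun m n hmn =>
      lintegral_mono fun x => min_le_min le_rfl (by exact_mod_cast hmn))
  have hge : ∫⁻ x, g x = ⨆ n : ℕ, ∫⁻ x, min (g x) n :=
    tendsto_nhds_unique (lintegral_trunc hg) (tendsto_atTop_iSup fun m n hmn =>
      lintegral_mono fun x => min_le_min le_rfl (by exact_mod_cast hmn))
  have pw : ∀ (k : ℕ → ℝ≥0∞) (r : ℝ), 0 < r → (⨆ n, k n) ^ r = ⨆ n, k n ^ r := by
    intro k r hr
    exact (ENNReal.orderIsoRpow r hr).map_iSup k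
  rw [hfe, hge, pw _ _ hl, pw _ _ h0, ENNReal.iSup_mul]
  refine iSup_le fun n => ?_
  rw [ENNReal.mul_iSup]
  exact iSup_le fun m => key n m

theorem pl_fin (m : ℕ) : ∀ {f g h : (Fin m → ℝ) → ℝ≥0∞} (_ : Measurable f) (_ : Measurable g)
    (_ : Measurable h) {l : ℝ} (_ : 0 < l) (_ : l < 1)
    (_ : ∀ x y, f x ^ (1 - l) * g y ^ l ≤ h ((1 - l) • x + l • y)),
    (∫⁻ x, f x) ^ (1 - l) * (∫⁻ x, g x) ^ l ≤ ∫⁻ x, h x := by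
  induction m with
  | zero =>
    intro f g h hf hg hh l h0 h1 hyp
    simp only [lintegral_unique]
    have : (volume (Set.univ : Set (Fin 0 → ℝ))) = 1 := by
      rw [volume_pi, Measure.pi_univ]; simp
    simp only [this, mul_one]
    have key : ∀ x y z : Fin 0 → ℝ, f x ^ (1 - l) * g y ^ l ≤ h z := by
      intro x y z
      refine (hyp x y).trans (le_of_eq ?_)
      congr 1
      exact Subsingleton.elim _ _
    exact key _ _ _
  | succ m ih =>
    intro f g h hf hg hh l h0 h1 hyp
    have e := (volume_preserving_piFinSuccAbove (fun _ : Fin (m + 1) => ℝ) 0).symm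
    have he : ∀ z : ℝ × (Fin m → ℝ), (MeasurableEquiv.piFinSuccAbove (fun _ : Fin (m + 1) => ℝ) 0).symm z
        = (Fin.cons z.1 z.2 : Fin (m+1) → ℝ) := by
      intro z
      simp [MeasurableEquiv.piFinSuccAbove, Fin.insertNthEquiv]
    have hcm : Measurable fun z : ℝ × (Fin m → ℝ) => (Fin.cons z.1 z.2 : Fin (m+1) → ℝ) := by
      refine (funext he : _ = _) ▸ e.measurable
    have tr : ∀ k : (Fin (m + 1) → ℝ) → ℝ≥0∞, Measurable k → ∫⁻ x, k x =
        ∫⁻ t : ℝ, ∫⁻ y : Fin m → ℝ, k (Fin.cons t y) := by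
      intro k hk
      rw [← e.lintegral_comp hk]
      erw [lintegral_prod]
      · simp only [he]
      · exact (hk.comp e.measurable).aemeasurable
    rw [tr f hf, tr g hg, tr h hh]
    refine pl_one (hf.comp hcm).lintegral_prod_right' (hg.comp hcm).lintegral_prod_right' (hh.comp hcm).lintegral_prod_right' h0 h1 ?_
    intro s t
    refine ih (f := fun y => f (Fin.cons s y)) (g := fun y => g (Fin.cons t y))
      (h := fun y => h (Fin.cons ((1 - l) * s + l * t) y)) ?_ ?_ ?_ h0 h1 ?_
    · exact hf.comp (hcm.comp measurable_prodMk_left)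
    · exact hg.comp (hcm.comp measurable_prodMk_left)
    · exact hh.comp (hcm.comp measurable_prodMk_left)
    · intro x y
      refine (hyp _ _).trans (le_of_eq ?_)
      congr 1
      ext i
      refine Fin.cases ?_ (fun j => ?_) i <;> simp

end Part1

section Part2

lemma oned_smooth {α β k : ℝ} (hab : α < β) (hk : 0 < k) (hkL : k * (β - α) < π)
    {φ φ1 φ2 v v' : ℝ → ℝ} (hφ : ∀ x, HasDerivAt φ (φ1 x) x) (hφ1 : ∀ x, HasDerivAt φ1 (φ2 x) x)
    (hφ2 : ∀ x ∈ Set.Icc α β, 0 ≤ φ2 x) (hv : ∀ x, HasDerivAt v (v' x) x) (hv' : Continuous v')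
    (hmean : ∫ x in α..β, v x * exp (-φ x) = 0) :
    0 ≤ ∫ x in α..β, (v' x ^ 2 - k ^ 2 * v x ^ 2) * exp (-φ x) := by
  have cφ : Continuous φ := continuous_iff_continuousAt.2 fun x => (hφ x).continuousAt
  have cv : Continuous v := continuous_iff_continuousAt.2 fun x => (hv x).continuousAt
  set F : ℝ → ℝ := fun x => ∫ y in α..x, v y * exp (-φ y) with hF
  have dF : ∀ x, HasDerivAt F (v x * exp (-φ x)) x := fun x =>
    ((by fun_prop : Continuous fun y => v y * exp (-φ y)).integral_hasStrictDerivAt α x).hasDerivAt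
  set I : ℝ → ℝ := fun x => ∫ y in α..x, (v' y ^ 2 - k ^ 2 * v y ^ 2) * exp (-φ y) with hI
  have dI : ∀ x, HasDerivAt I ((v' x ^ 2 - k ^ 2 * v x ^ 2) * exp (-φ x)) x := fun x =>
    ((by fun_prop : Continuous fun y => (v' y ^ 2 - k ^ 2 * v y ^ 2) * exp (-φ y)).integral_hasStrictDerivAt α x).hasDerivAt
  set m := (α + β) / 2 with hm
  set a : ℝ → ℝ := fun x => - k * tan (k * (x - m)) - φ1 x / 2 with ha
  have hcos : ∀ x ∈ Set.Icc α β, 0 < cos (k * (x - m)) := by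
    intro x hx
    apply cos_pos_of_mem_Ioo
    have h1 : k * (x - m) ≤ k * ((β - α) / 2) := by
      apply mul_le_mul_of_nonneg_left _ hk.le; rw [hm]; linarith [hx.2]
    have h2 : -(k * ((β - α) / 2)) ≤ k * (x - m) := by
      rw [← mul_neg]
      apply mul_le_mul_of_nonneg_left _ hk.le; rw [hm]; linarith [hx.1]
    constructor <;> nlinarith
  have da : ∀ x ∈ Set.Icc α β, HasDerivAt a (- k ^ 2 * (1 + tan (k * (x - m)) ^ 2) - φ2 x / 2) x := by
    intro x hx
    have h1 : HasDerivAt (fun x => k * (x - m)) (k * 1) x := ((hasDerivAt_id x).sub_const m).const_mul k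
    have h2 := (hasDerivAt_tan (hcos x hx).ne').comp x h1
    have h3 := (h2.const_mul (-k)).sub ((hφ1 x).div_const 2)
    refine HasDerivAt.congr_deriv h3 ?_
    rw [tan_eq_sin_div_cos]
    have := (hcos x hx).ne'
    have s := sin_sq_add_cos_sq (k * (x - m))
    field_simp
    nlinarith
  set B : ℝ → ℝ := fun x => - 2 * k ^ 2 * (v x * F x) + k ^ 2 * (F x ^ 2 * exp (φ x) * a x) with hB
  have dG : ∀ x ∈ Set.Icc α β, ∃ g, 0 ≤ g ∧ HasDerivAt (fun x => I x - B x) g x := by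
    intro x hx
    have d1 := (((hv x).mul (dF x)).const_mul (-2 * k ^ 2)).add
      ((((dF x).pow 2).mul (hφ x).exp |>.mul (da x hx)).const_mul (k ^ 2))
    refine ⟨_, ?_, (dI x).sub d1⟩
    have hpw : exp (-φ x) * exp (φ x) = 1 := by rw [← exp_add]; simp
    set w := exp (φ x)
    set p := exp (-φ x)
    have hw : 0 < w := exp_pos _
    set T := tan (k * (x - m))
    have hax : a x = -k * T - φ1 x / 2 := rfl
    have hr := hφ2 x hx
    set f := F x
    have : 0 ≤ w * (p * v' x + k ^ 2 * f) ^ 2 + k ^ 2 * (w * (p * v x - f * a x) ^ 2)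
      + k ^ 2 * (f ^ 2 * w * (φ2 x / 2 + φ1 x ^ 2 / 4)) := by positivity
    refine this.trans (le_of_eq ?_)
    simp only [Pi.mul_apply, Pi.pow_apply, Nat.cast_ofNat]
    rw [hax]
    have hp : p = w⁻¹ := eq_inv_of_mul_eq_one_left hpw
    rw [hp]
    field_simp
    ring
  have hmono : MonotoneOn (fun x => I x - B x) (Set.Icc α β) := by
    apply monotoneOn_of_deriv_nonneg (convex_Icc α β)
    · intro x hx
      obtain ⟨g, -, h⟩ := dG x hx
      exact h.continuousAt.continuousWithinAt
    · intro x hx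
      obtain ⟨g, -, h⟩ := dG x (interior_subset hx)
      exact h.differentiableAt.differentiableWithinAt
    · intro x hx
      obtain ⟨g, h0, h⟩ := dG x (interior_subset hx)
      rw [h.deriv]; exact h0
  have := hmono (Set.left_mem_Icc.2 hab.le) (Set.right_mem_Icc.2 hab.le) hab.le
  have Fa : F α = 0 := by simp [hF]
  have Fb : F β = 0 := hmean
  have Ia : I α = 0 := by simp [hI]
  simp only [hB, Fa, Fb, Ia] at this
  simpa [hI] using this

/-- variance form -/
lemma oned_smooth_var {α β k : ℝ} (hab : α < β) (hk : 0 < k) (hkL : k * (β - α) < π)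
    {φ φ1 φ2 v v' : ℝ → ℝ} (hφ : ∀ x, HasDerivAt φ (φ1 x) x) (hφ1 : ∀ x, HasDerivAt φ1 (φ2 x) x)
    (hφ2 : ∀ x ∈ Set.Icc α β, 0 ≤ φ2 x) (hv : ∀ x, HasDerivAt v (v' x) x) (hv' : Continuous v') :
    k ^ 2 * ((∫ x in α..β, exp (-φ x)) * (∫ x in α..β, v x ^ 2 * exp (-φ x)) -
      (∫ x in α..β, v x * exp (-φ x)) ^ 2) ≤
      (∫ x in α..β, exp (-φ x)) * ∫ x in α..β, v' x ^ 2 * exp (-φ x) := by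
  have cφ : Continuous φ := continuous_iff_continuousAt.2 fun x => (hφ x).continuousAt
  have cv : Continuous v := continuous_iff_continuousAt.2 fun x => (hv x).continuousAt
  set P := ∫ x in α..β, exp (-φ x) with hP
  set M := ∫ x in α..β, v x * exp (-φ x) with hM
  set Q := ∫ x in α..β, v x ^ 2 * exp (-φ x) with hQ
  set R := ∫ x in α..β, v' x ^ 2 * exp (-φ x) with hR
  have Ppos : 0 < P := intervalIntegral.intervalIntegral_pos_of_pos
    ((by fun_prop : Continuous fun x => exp (-φ x)).intervalIntegrable _ _) (fun x => exp_pos _) hab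
  have i0 : IntervalIntegrable (fun x => exp (-φ x)) volume α β := Continuous.intervalIntegrable (by fun_prop) _ _
  have i1 : IntervalIntegrable (fun x => v x * exp (-φ x)) volume α β := Continuous.intervalIntegrable (by fun_prop) _ _
  have i2 : IntervalIntegrable (fun x => v x ^ 2 * exp (-φ x)) volume α β := Continuous.intervalIntegrable (by fun_prop) _ _
  have i3 : IntervalIntegrable (fun x => v' x ^ 2 * exp (-φ x)) volume α β := Continuous.intervalIntegrable (by fun_prop) _ _
  set c := M / P with hc
  have key := oned_smooth hab hk hkL hφ hφ1 hφ2 (v := fun x => v x - c) (v' := v')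
    (fun x => (hv x).sub_const c) hv' (by
      have : (fun x => (v x - c) * exp (-φ x)) = fun x => v x * exp (-φ x) - c * exp (-φ x) := by
        ext x; ring
      rw [this, intervalIntegral.integral_sub i1 (i0.const_mul c), intervalIntegral.integral_const_mul,
        ← hM, ← hP, hc]
      field_simp
      simp)
  have e : ∀ x, (v' x ^ 2 - k ^ 2 * (v x - c) ^ 2) * exp (-φ x) =
      v' x ^ 2 * exp (-φ x) - k ^ 2 * (v x ^ 2 * exp (-φ x)) + ((2 * k ^ 2 * c) * (v x * exp (-φ x))
        - (k ^ 2 * c ^ 2) * exp (-φ x)) := fun x => by ring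
  simp only [e] at key
  rw [intervalIntegral.integral_add (i3.sub (i2.const_mul _)) ((i1.const_mul _).sub (i0.const_mul _)),
    intervalIntegral.integral_sub i3 (i2.const_mul _),
    intervalIntegral.integral_sub (i1.const_mul _) (i0.const_mul _)] at key
  simp only [intervalIntegral.integral_const_mul] at key
  rw [← hM, ← hP, ← hQ, ← hR] at key
  have h2 := mul_nonneg Ppos.le key
  have hcP : c * P = M := by rw [hc]; field_simp
  rw [← hcP] at h2 ⊢
  nlinarith [h2]

/-- Steklov average -/
def stek (η : ℝ) (φ : ℝ → ℝ) (x : ℝ) : ℝ := η⁻¹ * ((∫ y in (0:ℝ)..(x + η), φ y) - ∫ y in (0:ℝ)..x, φ y)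

lemma stek_hasDerivAt {η : ℝ} {φ : ℝ → ℝ} (hφ : Continuous φ) (x : ℝ) :
    HasDerivAt (stek η φ) (η⁻¹ * (φ (x + η) - φ x)) x := by
  have h : ∀ z, HasDerivAt (fun x => ∫ y in (0:ℝ)..x, φ y) (φ z) z := fun z =>
    (hφ.integral_hasStrictDerivAt 0 z).hasDerivAt
  exact (((h (x + η)).comp_add_const x η).sub (h x)).const_mul _

lemma stek_continuous {η : ℝ} {φ : ℝ → ℝ} (hφ : Continuous φ) : Continuous (stek η φ) :=
  continuous_iff_continuousAt.2 fun x => (stek_hasDerivAt hφ x).continuousAt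

lemma stek_close {η ε : ℝ} (hη : 0 < η) {φ : ℝ → ℝ} (hφ : Continuous φ) {x c : ℝ}
    (h : ∀ y ∈ Set.Icc x (x + η), |φ y - c| ≤ ε) : |stek η φ x - c| ≤ ε := by
  have i : ∀ a b, IntervalIntegrable φ volume a b := fun a b => hφ.intervalIntegrable _ _
  have e : stek η φ x - c = η⁻¹ * ∫ y in x..(x + η), (φ y - c) := by
    rw [intervalIntegral.integral_sub (i _ _) (by simp), stek,
      intervalIntegral.integral_interval_sub_left (i _ _) (i _ _)]
    simp
    field_simp
  rw [e, abs_mul, abs_of_pos (inv_pos.2 hη)]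
  have := intervalIntegral.norm_integral_le_of_norm_le_const (a := x) (b := x + η) (f := fun y => φ y - c) (C := ε)
    (fun y hy => by
      rw [Set.uIoc_of_le (by linarith)] at hy
      exact h y ⟨hy.1.le, hy.2⟩)
  simp only [norm_eq_abs, add_sub_cancel_left, abs_of_pos hη] at this
  rw [inv_mul_le_iff₀ hη]
  linarith

lemma oned_cont {α β γ k : ℝ} (hab : α < β) (hbg : β < γ) (hk : 0 < k) (hkL : k * (β - α) < π)
    {φ v v' : ℝ → ℝ} (hφ : UniformContinuous φ) (hconv : ConvexOn ℝ (Set.Icc α γ) φ)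
    (hv : ∀ x, HasDerivAt v (v' x) x) (hv' : Continuous v') :
    k ^ 2 * ((∫ x in α..β, exp (-φ x)) * (∫ x in α..β, v x ^ 2 * exp (-φ x)) -
      (∫ x in α..β, v x * exp (-φ x)) ^ 2) ≤
      (∫ x in α..β, exp (-φ x)) * ∫ x in α..β, v' x ^ 2 * exp (-φ x) := by
  have cφ := hφ.continuous
  have cv : Continuous v := continuous_iff_continuousAt.2 fun x => (hv x).continuousAt
  have hseq : ∀ ε : ℝ, 0 < ε → ∃ ψ : ℝ → ℝ, Continuous ψ ∧ (∀ x, |ψ x - φ x| ≤ ε) ∧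
      ∃ ψ1 ψ2 : ℝ → ℝ, (∀ x, HasDerivAt ψ (ψ1 x) x) ∧ (∀ x, HasDerivAt ψ1 (ψ2 x) x) ∧
        ∀ x ∈ Set.Icc α β, 0 ≤ ψ2 x := by
    intro ε hε
    obtain ⟨δ, hδ, hd⟩ := Metric.uniformContinuous_iff.1 hφ ε hε
    set η := min (δ / 4) ((γ - β) / 4) with hη
    have hη0 : 0 < η := by rw [hη]; apply lt_min <;> linarith
    have hη1 : η ≤ δ / 4 := min_le_left _ _
    have hη2 : η ≤ (γ - β) / 4 := min_le_right _ _
    refine ⟨stek η (stek η φ), stek_continuous (stek_continuous cφ), ?_,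
      fun x => η⁻¹ * (stek η φ (x + η) - stek η φ x),
      fun x => η⁻¹ * (η⁻¹ * (φ (x + η + η) - φ (x + η)) - η⁻¹ * (φ (x + η) - φ x)),
      fun x => stek_hasDerivAt (stek_continuous cφ) x, ?_, ?_⟩
    · intro x
      refine stek_close hη0 (stek_continuous cφ) fun y hy => ?_
      refine stek_close hη0 cφ fun z hz => ?_
      have := hd (a := z) (b := x) (by
        rw [Real.dist_eq, abs_of_nonneg (by linarith [hy.1, hz.1])]; linarith [hy.2, hz.2])
      rw [Real.dist_eq] at this
      exact this.le
    · intro x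
      exact (((stek_hasDerivAt cφ (x + η)).comp_add_const x η).sub (stek_hasDerivAt cφ x)).const_mul _
    · intro x hx
      have m1 : x ∈ Set.Icc α γ := ⟨hx.1, by linarith [hx.2]⟩
      have m2 : x + η + η ∈ Set.Icc α γ := ⟨by linarith [hx.1], by linarith [hx.2]⟩
      have h := hconv.2 m1 m2 (by norm_num : (0:ℝ) ≤ 1/2) (by norm_num : (0:ℝ) ≤ 1/2) (by norm_num)
      have e : (1/2 : ℝ) • x + (1/2 : ℝ) • (x + η + η) = x + η := by simp; ring
      rw [e] at h
      simp only [smul_eq_mul] at h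
      have : η⁻¹ * (η⁻¹ * (φ (x + η + η) - φ (x + η)) - η⁻¹ * (φ (x + η) - φ x)) =
        η⁻¹ * η⁻¹ * (φ (x + η + η) - 2 * φ (x + η) + φ x) := by ring
      beta_reduce
      rw [this]
      have : 0 < η⁻¹ := inv_pos.2 hη0
      apply mul_nonneg (by positivity)
      linarith
  choose ψ hψc hψd ψ1 ψ2 h1 h2 h3 using fun n : ℕ => hseq (1 / ((n:ℝ) + 1)) (by positivity)
  have hlim : ∀ x, Tendsto (fun n => ψ n x) atTop (nhds (φ x)) := by
    intro x
    rw [tendsto_iff_norm_sub_tendsto_zero]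
    exact squeeze_zero (fun n => norm_nonneg _) (fun n => hψd n x) tendsto_one_div_add_atTop_nhds_zero_nat
  have hIntg : ∀ g : ℝ → ℝ, Continuous g → Tendsto (fun n => ∫ x in α..β, g x * exp (-ψ n x)) atTop
      (nhds (∫ x in α..β, g x * exp (-φ x))) := by
    intro g hg
    apply intervalIntegral.tendsto_integral_filter_of_dominated_convergence (fun x => |g x| * exp (-φ x + 1))
    · exact Eventually.of_forall fun n => ((hg.mul ((hψc n).neg.rexp)).aestronglyMeasurable)
    · refine Eventually.of_forall fun n => Eventually.of_forall fun x _ => ?_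
      rw [norm_mul, norm_eq_abs, norm_eq_abs, abs_of_pos (exp_pos _)]
      gcongr
      have := (abs_le.1 (hψd n x)).1
      have h' : 1 / ((n:ℝ) + 1) ≤ 1 := by
        rw [div_le_one (by positivity)]; linarith [(Nat.cast_nonneg n : (0:ℝ) ≤ n)]
      linarith
    · exact Continuous.intervalIntegrable (by fun_prop) _ _
    · refine Eventually.of_forall fun x _ => ?_
      exact ((hlim x).neg.rexp).const_mul _
  have t0 := hIntg (fun _ => 1) continuous_const
  simp only [one_mul] at t0
  have t1 := hIntg v cv
  have t2 := hIntg (fun x => v x ^ 2) (by fun_prop)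
  have t3 := hIntg (fun x => v' x ^ 2) (by fun_prop)
  exact le_of_tendsto_of_tendsto' (((t0.mul t2).sub (t1.pow 2)).const_mul _) (t0.mul t3)
    (fun n => oned_smooth_var hab hk hkL (h1 n) (h2 n) (h3 n) hv hv')

end Part2

section Part3

lemma oned_logconcave {D k : ℝ} (hk : 0 < k) (hkD : k * D ≤ π) {p v v' : ℝ → ℝ}
    (hp0 : ∀ t, 0 ≤ p t) (hpi : Integrable p) (hpos : 0 < ∫ t, p t)
    (hD : ∀ s t, 0 < p s → 0 < p t → |s - t| ≤ D)
    (hlc : ∀ s t l, 0 < l → l < 1 → 0 < p s → 0 < p t →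
      p s ^ (1 - l) * p t ^ l ≤ p ((1 - l) * s + l * t))
    (hv : ∀ x, HasDerivAt v (v' x) x) (hv' : Continuous v') :
    k ^ 2 * ((∫ x, p x) * (∫ x, v x ^ 2 * p x) - (∫ x, v x * p x) ^ 2) ≤
      (∫ x, p x) * ∫ x, v' x ^ 2 * p x := by
  have cv : Continuous v := continuous_iff_continuousAt.2 fun x => (hv x).continuousAt
  set I : Set ℝ := {t | 0 < p t} with hI
  have hIne : I.Nonempty := by
    by_contra h
    rw [Set.not_nonempty_iff_eq_empty] at h
    have : ∀ t, p t = 0 := fun t => le_antisymm (not_lt.1 fun h' => by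
      have : t ∈ I := h'
      rw [h] at this; exact this) (hp0 t)
    simp [this] at hpos
  obtain ⟨t0, ht0⟩ := hIne
  have hba : BddAbove I := ⟨t0 + D, fun t ht => by
    have := hD t t0 ht ht0
    linarith [(abs_le.1 this).2]⟩
  have hbb : BddBelow I := ⟨t0 - D, fun t ht => by
    have := hD t t0 ht ht0
    linarith [(abs_le.1 this).1]⟩
  set α := sInf I with hα
  set β := sSup I with hβ
  have hsub : I ⊆ Set.Icc α β := fun t ht => ⟨csInf_le hbb ht, le_csSup hba ht⟩
  have hz : ∀ t, t ∉ Set.Icc α β → p t = 0 := fun t ht =>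
    le_antisymm (not_lt.1 fun h' => ht (hsub h')) (hp0 t)
  have hIc : ∀ s t l, 0 < l → l < 1 → s ∈ I → t ∈ I → (1 - l) * s + l * t ∈ I := by
    intro s t l h0 h1 hs ht
    exact lt_of_lt_of_le (mul_pos (rpow_pos_of_pos hs _) (rpow_pos_of_pos ht _)) (hlc s t l h0 h1 hs ht)
  have hIoo : Set.Ioo α β ⊆ I := by
    intro x hx
    obtain ⟨s, hs, hsx⟩ := exists_lt_of_csInf_lt ⟨t0, ht0⟩ hx.1
    obtain ⟨t, ht, hxt⟩ := exists_lt_of_lt_csSup ⟨t0, ht0⟩ hx.2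
    have h := hIc s t ((x - s) / (t - s)) (div_pos (by linarith) (by linarith))
      ((div_lt_one (by linarith)).2 (by linarith)) hs ht
    have e : (1 - (x - s) / (t - s)) * s + (x - s) / (t - s) * t = x := by
      have : t - s ≠ 0 := by linarith
      field_simp
      ring
    rwa [e] at h
  have hgi : ∀ g : ℝ → ℝ, Continuous g → Integrable fun x => g x * p x := by
    intro g hg
    rw [← integrableOn_iff_integrable_of_support_subset (s := Set.Icc α β)]
    · exact hpi.integrableOn.continuousOn_mul hg.continuousOn isCompact_Icc
    · intro x hx
      by_contra h
      simp [hz x h] at hx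
  have hab0 : α ≤ β := (csInf_le hbb ht0).trans (le_csSup hba ht0)
  have hio : ∀ g : ℝ → ℝ, ∫ x, g x * p x = ∫ x in α..β, g x * p x := by
    intro g
    rw [intervalIntegral.integral_of_le hab0, ← integral_Icc_eq_integral_Ioc,
      setIntegral_eq_integral_of_forall_compl_eq_zero]
    intro x hx
    simp [hz x hx]
  have hab : α < β := by
    refine lt_of_le_of_ne hab0 fun h => ?_
    have := hio (fun _ => 1)
    simp only [one_mul, ← h, intervalIntegral.integral_same] at this
    linarith
  have hL : β - α ≤ D := by
    by_contra hc
    push Not at hc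
    set ε := (β - α - D) / 3 with hε
    have hε0 : 0 < ε := by rw [hε]; linarith
    obtain ⟨s, hs, hsx⟩ := exists_lt_of_csInf_lt ⟨t0, ht0⟩ (show α < α + ε by linarith)
    obtain ⟨t, ht, hxt⟩ := exists_lt_of_lt_csSup ⟨t0, ht0⟩ (show β - ε < β by linarith)
    have := (abs_le.1 (hD t s ht hs)).2
    linarith
  set φ : ℝ → ℝ := fun t => - log (p t) with hφ
  have hconv : ConvexOn ℝ (Set.Ioo α β) φ := by
    rw [convexOn_iff_forall_pos]
    refine ⟨convex_Ioo _ _, fun x hx y hy a b ha hb hab' => ?_⟩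
    have hpx : 0 < p x := hIoo hx
    have hpy : 0 < p y := hIoo hy
    have ha' : a = 1 - b := by linarith
    subst ha'
    have h := hlc x y b hb (by linarith) hpx hpy
    have h2 := log_le_log (mul_pos (rpow_pos_of_pos hpx _) (rpow_pos_of_pos hpy _)) h
    rw [log_mul (rpow_pos_of_pos hpx _).ne' (rpow_pos_of_pos hpy _).ne', log_rpow hpx, log_rpow hpy] at h2
    simp only [hφ, smul_eq_mul]
    linarith
  have hcont : ContinuousOn φ (Set.Ioo α β) := hconv.continuousOn isOpen_Ioo
  have hinner : ∀ s t, α < s → s < t → t < β →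
    k ^ 2 * ((∫ x in s..t, 1 * p x) * (∫ x in s..t, v x ^ 2 * p x) -
      (∫ x in s..t, v x * p x) ^ 2) ≤
      (∫ x in s..t, 1 * p x) * ∫ x in s..t, v' x ^ 2 * p x := by
    intro s t hs hst ht
    set γ := (t + β) / 2 with hγ
    have htg : t < γ := by rw [hγ]; linarith
    have hgb : γ < β := by rw [hγ]; linarith
    have hsg : s ≤ γ := by linarith
    have hss : Set.Icc s γ ⊆ Set.Ioo α β := fun x hx => ⟨by linarith [hx.1], by linarith [hx.2]⟩
    set φ' : ℝ → ℝ := Set.IccExtend hsg ((Set.Icc s γ).domRestrict φ) with hφ'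
    have heq : ∀ x ∈ Set.Icc s γ, φ' x = φ x := fun x hx => by
      rw [hφ', Set.IccExtend_of_mem _ _ hx]; rfl
    have huc : UniformContinuous φ' := by
      have h1 : UniformContinuous ((Set.Icc s γ).domRestrict φ) :=
        CompactSpace.uniformContinuous_of_continuous (hcont.mono hss).domRestrict
      exact h1.comp (LipschitzWith.projIcc hsg).uniformContinuous
    have hcv : ConvexOn ℝ (Set.Icc s γ) φ' := (hconv.subset hss (convex_Icc _ _)).congr
      (fun x hx => (heq x hx).symm)
    have key := oned_cont hst htg hk (by
      have : k * (t - s) < k * D := by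
        apply mul_lt_mul_of_pos_left _ hk; linarith
      linarith) huc hcv hv hv'
    have e : ∀ g : ℝ → ℝ, ∫ x in s..t, g x * p x = ∫ x in s..t, g x * exp (-φ' x) := by
      intro g
      apply intervalIntegral.integral_congr
      intro x hx
      rw [Set.uIcc_of_le hst.le] at hx
      have hx' : x ∈ Set.Icc s γ := ⟨hx.1, by linarith [hx.2]⟩
      simp only [heq x hx', hφ, neg_neg]
      rw [exp_log (hIoo (hss hx'))]
    have e1 := e (fun _ => 1)
    rw [e1, e v, e (fun x => v x ^ 2), e (fun x => v' x ^ 2)]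
    simp only [one_mul]
    exact key
  set A : ℕ → ℝ := fun n => α + (β - α) / 3 * (1 / ((n:ℝ) + 1)) with hA
  set B : ℕ → ℝ := fun n => β - (β - α) / 3 * (1 / ((n:ℝ) + 1)) with hB
  have tA : Tendsto A atTop (nhds α) := by
    have := (tendsto_one_div_add_atTop_nhds_zero_nat (𝕜 := ℝ)).const_mul ((β - α) / 3) |>.const_add α
    simpa [hA, hB] using this
  have tB : Tendsto B atTop (nhds β) := by
    have := (tendsto_one_div_add_atTop_nhds_zero_nat (𝕜 := ℝ)).const_mul ((β - α) / 3) |>.const_sub β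
    simpa [hA, hB] using this
  have hlim : ∀ g : ℝ → ℝ, Continuous g → Tendsto (fun n => ∫ x in (A n)..(B n), g x * p x) atTop
      (nhds (∫ x, g x * p x)) := by
    intro g hg
    have hi := hgi g hg
    have hc := intervalIntegral.continuous_primitive (fun a b => hi.intervalIntegrable (a := a) (b := b)) 0
    rw [hio g, ← intervalIntegral.integral_interval_sub_left hi.intervalIntegrable hi.intervalIntegrable (a := 0)]
    have := ((hc.tendsto β).comp tB).sub ((hc.tendsto α).comp tA)
    refine this.congr fun n => ?_
    simp only [Function.comp]
    rw [intervalIntegral.integral_interval_sub_left hi.intervalIntegrable hi.intervalIntegrable]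
  have t0 := hlim (fun _ => 1) continuous_const
  have t1 := hlim v cv
  have t2 := hlim (fun x => v x ^ 2) (by fun_prop)
  have t3 := hlim (fun x => v' x ^ 2) (by fun_prop)
  have := le_of_tendsto_of_tendsto' (((t0.mul t2).sub (t1.pow 2)).const_mul (k ^ 2)) (t0.mul t3)
    (fun n => by
      have hn : 0 < 1 / ((n:ℝ) + 1) := by positivity
      have hn1 : 1 / ((n:ℝ) + 1) ≤ 1 := by
        rw [div_le_one (by positivity)]; linarith [(Nat.cast_nonneg n : (0:ℝ) ≤ n)]
      have hd : 0 < (β - α) / 3 := by linarith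
      have h3 : 0 < (β - α) / 3 * (1 / ((n:ℝ) + 1)) := mul_pos hd hn
      have h4 : (β - α) / 3 * (1 / ((n:ℝ) + 1)) ≤ (β - α) / 3 := by
        nlinarith
      apply hinner <;> simp only [hA, hB] <;> linarith)
  simpa using this

end Part3

section Part4

open scoped ENNReal

lemma exists_param {m : ℕ} (e : Euc (m + 1)) (he : ‖e‖ = 1) :
    ∃ Ψ : ℝ × (Fin m → ℝ) → Euc (m + 1), Continuous Ψ ∧ MeasurePreserving Ψ volume volume ∧
      (∀ z w (a b : ℝ), Ψ (a • z + b • w) = a • Ψ z + b • Ψ w) ∧ (∀ z, inner ℝ e (Ψ z) = z.1) ∧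
      ∃ c : Euc (m + 1) → (Fin m → ℝ), Continuous c ∧ ∀ z, c (Ψ z) = z.2 := by
  obtain ⟨b, hb⟩ := Orthonormal.exists_orthonormalBasis_extension_of_card_eq (𝕜 := ℝ) (ι := Fin (m + 1))
    (E := Euc (m + 1)) (by simp) (v := fun _ => e) (s := {0}) (by
      refine ⟨fun i => by simpa using he, fun i j hij => ?_⟩
      exact absurd (Subsingleton.elim i j) hij)
  have hb0 : b 0 = e := hb 0 rfl
  have mp := (volume_preserving_piFinSuccAbove (fun _ : Fin (m + 1) => ℝ) 0).symm
  have hE : ∀ z : ℝ × (Fin m → ℝ), (MeasurableEquiv.piFinSuccAbove (fun _ : Fin (m + 1) => ℝ) 0).symm z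
        = (Fin.cons z.1 z.2 : Fin (m+1) → ℝ) := by
      intro z
      simp [MeasurableEquiv.piFinSuccAbove, Fin.insertNthEquiv]
  have hE' : ⇑(MeasurableEquiv.piFinSuccAbove (fun _ : Fin (m + 1) => ℝ) 0).symm =
    fun z : ℝ × (Fin m → ℝ) => (Fin.cons z.1 z.2 : Fin (m+1) → ℝ) := funext hE
  rw [hE'] at mp
  have mp2 := (PiLp.volume_preserving_toLp (Fin (m + 1))).comp mp
  have mp3 := b.measurePreserving_repr_symm.comp mp2
  have hcoord : ∀ (z : ℝ × (Fin m → ℝ)) (i : Fin (m + 1)), inner ℝ (b i) (b.repr.symm (WithLp.toLp 2 (Fin.cons z.1 z.2 : Fin (m+1) → ℝ))) =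
      (Fin.cons z.1 z.2 : Fin (m+1) → ℝ) i := by
    intro z i
    rw [← b.repr_apply_apply, LinearIsometryEquiv.apply_symm_apply]
  refine ⟨_, ?_, mp3, ?_, ?_, fun x i => inner ℝ (b i.succ) x, by fun_prop, ?_⟩
  · simp only [Function.comp_def]
    refine b.repr.symm.continuous.comp ((PiLp.continuous_toLp 2 _).comp ?_)
    refine continuous_pi fun i => ?_
    refine Fin.cases ?_ (fun j => ?_) i
    · simpa using continuous_fst
    · simp only [Fin.cons_succ]
      exact (continuous_apply j).comp continuous_snd
  · intro z w a c
    simp only [Function.comp_def]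
    rw [← map_smul, ← map_smul, ← map_add]
    congr 1
    ext i
    refine Fin.cases ?_ (fun j => ?_) i <;> simp
  · intro z
    have := hcoord z 0
    rw [hb0] at this
    simpa using this
  · intro z
    ext i
    simpa using hcoord z i.succ

lemma exists_marginal {m : ℕ} (e : Euc (m + 1)) (he : ‖e‖ = 1) {C : Set (Euc (m + 1))}
    (hC : IsCompact C) (hconv : Convex ℝ C) :
    ∃ p : ℝ → ℝ, (∀ t, 0 ≤ p t) ∧ Integrable p ∧ (∀ t, 0 < p t → ∃ x ∈ C, inner ℝ e x = t) ∧
      (∀ s t l, 0 < l → l < 1 → 0 < p s → 0 < p t →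
        p s ^ (1 - l) * p t ^ l ≤ p ((1 - l) * s + l * t)) ∧
      ∀ g : ℝ → ℝ, Continuous g → ∫ x in C, g (inner ℝ e x) = ∫ t, g t * p t := by
  obtain ⟨Ψ, hΨc, hΨm, hΨl, hΨe, c, hc, hcΨ⟩ := exists_param e he
  set S : ℝ → Set (Fin m → ℝ) := fun t => {y | Ψ (t, y) ∈ C} with hS
  have hSm : ∀ t, MeasurableSet (S t) := fun t =>
    (hC.isClosed.preimage (hΨc.comp (Continuous.prodMk_right t))).measurableSet
  set P : ℝ → ℝ≥0∞ := fun t => volume (S t) with hP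
  have hPfin : ∀ t, P t ≠ ∞ := by
    intro t
    refine ne_top_of_le_ne_top (hC.image hc).measure_lt_top.ne (measure_mono ?_)
    intro y hy
    exact ⟨Ψ (t, y), hy, hcΨ _⟩
  have hCm : MeasurableSet C := hC.measurableSet
  have hPm : Measurable P := by
    have : P = fun t => volume (Prod.mk t ⁻¹' (Ψ ⁻¹' C)) := rfl
    rw [this]
    exact measurable_measure_prodMk_left (hΨc.measurable hCm)
  have hmap : Measure.map (fun x => inner ℝ e x) (volume.restrict C) = volume.withDensity P := by
    ext A hA
    have hm : Measurable fun x : Euc (m + 1) => inner ℝ e x := by fun_prop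
    rw [Measure.map_apply hm hA, Measure.restrict_apply (hm hA), withDensity_apply _ hA,
      ← hΨm.measure_preimage ((hm hA).inter hCm).nullMeasurableSet]
    erw [Measure.prod_apply (hΨc.measurable ((hm hA).inter hCm))]
    rw [← lintegral_indicator hA]
    refine lintegral_congr fun t => ?_
    by_cases ht : t ∈ A
    · rw [Set.indicator_of_mem ht]
      congr 1
      ext y
      simp [hΨe, ht, hS]
    · rw [Set.indicator_of_notMem ht]
      convert measure_empty (μ := (volume : Measure (Fin m → ℝ)))
      ext y
      simp [hΨe, ht]
  have hPi : ∫⁻ t, P t ≠ ∞ := by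
    have := congrArg (fun μ => μ Set.univ) hmap
    simp only [withDensity_apply _ MeasurableSet.univ, Measure.restrict_univ] at this
    rw [← this, Measure.map_apply (by fun_prop) MeasurableSet.univ]
    simpa using hC.measure_lt_top.ne
  have hlc : ∀ s t l, 0 < l → l < 1 → P s ^ (1 - l) * P t ^ l ≤ P ((1 - l) * s + l * t) := by
    intro s t l h0 h1
    have h := pl_fin m (f := (S s).indicator 1) (g := (S t).indicator 1) (h := (S ((1 - l) * s + l * t)).indicator 1)
      (measurable_one.indicator (hSm _)) (measurable_one.indicator (hSm _)) (measurable_one.indicator (hSm _)) h0 h1 (by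
        intro x y
        by_cases hx : x ∈ S s
        · by_cases hy : y ∈ S t
          · have : (1 - l) • x + l • y ∈ S ((1 - l) * s + l * t) := by
              have := hconv hx hy (by linarith : 0 ≤ 1 - l) h0.le (by ring)
              rw [← hΨl] at this
              exact this
            simp [hx, hy, this]
          · simp [hy, h0]
        · have : 0 < 1 - l := by linarith
          simp [hx, this])
    simpa [lintegral_indicator_one (hSm _)] using h
  refine ⟨fun t => (P t).toReal, fun t => ENNReal.toReal_nonneg, integrable_toReal_of_lintegral_ne_top hPm.aemeasurable hPi, ?_, ?_, ?_⟩
  · intro t ht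
    have h1 : P t ≠ 0 := fun h => by simp [h] at ht
    obtain ⟨y, hy⟩ := nonempty_of_measure_ne_zero h1
    exact ⟨_, hy, hΨe _⟩
  · intro s t l h0 h1 _ _
    beta_reduce
    rw [ENNReal.toReal_rpow, ENNReal.toReal_rpow, ← ENNReal.toReal_mul]
    exact ENNReal.toReal_mono (hPfin _) (hlc s t l h0 h1)
  · intro g hg
    rw [← integral_map (φ := fun x => inner ℝ e x) (by fun_prop) hg.aestronglyMeasurable, hmap,
      integral_withDensity_eq_integral_toReal_smul hPm (Eventually.of_forall fun t => (hPfin t).lt_top)]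
    simp [mul_comm]

end Part4

section Part5

lemma hyperplane_null {d : ℕ} {i j : Fin d} (hij : i ≠ j) {a b : ℝ} (hab : a ^ 2 + b ^ 2 = 1) (q r : ℝ) :
    volume {x : Euc d | a * (x i - q) + b * (x j - r) = 0} = 0 := by
  set L : Euc d →ₗ[ℝ] ℝ := a • (EuclideanSpace.proj i : Euc d →L[ℝ] ℝ).toLinearMap + b • (EuclideanSpace.proj j : Euc d →L[ℝ] ℝ).toLinearMap with hL
  have hLx : ∀ x, L x = a * x i + b * x j := fun x => by simp [hL]
  set s : AffineSubspace ℝ (Euc d) := (AffineSubspace.mk' (a * q + b * r) (⊥ : Submodule ℝ ℝ)).comap L.toAffineMap with hs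
  have hmem : ∀ x, x ∈ s ↔ a * (x i - q) + b * (x j - r) = 0 := by
    intro x
    rw [hs, AffineSubspace.mem_comap, AffineSubspace.mem_mk']
    simp only [LinearMap.coe_toAffineMap, hLx, vsub_eq_sub, Submodule.mem_bot]
    constructor <;> intro h <;> linarith
  have hne : s ≠ ⊤ := by
    intro h
    have h0 := (hmem 0).1 (h ▸ AffineSubspace.mem_top ℝ _ _)
    have h1 := (hmem (EuclideanSpace.single i a + EuclideanSpace.single j b)).1 (h ▸ AffineSubspace.mem_top ℝ _ _)
    simp [hij, hij.symm] at h0 h1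
    nlinarith
  have := Measure.addHaar_affineSubspace volume s hne
  convert this using 2
  ext x
  simp [hmem]

lemma cut_exists {d : ℕ} {i j : Fin d} (hij : i ≠ j) (q r : ℝ) {K : Set (Euc d)} (hK : IsCompact K)
    {u : Euc d → ℝ} (hu : Continuous u) (h0 : ∫ x in K, u x = 0) :
    ∃ a b : ℝ, a ^ 2 + b ^ 2 = 1 ∧
      ∫ x in K ∩ {x | 0 ≤ a * (x i - q) + b * (x j - r)}, u x = 0 ∧
      ∫ x in K ∩ {x | 0 ≤ (-a) * (x i - q) + (-b) * (x j - r)}, u x = 0 := by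
  set H : ℝ → Set (Euc d) := fun θ => {x | 0 ≤ cos θ * (x i - q) + sin θ * (x j - r)} with hH
  have hHm : ∀ θ, MeasurableSet (H θ) := fun θ => by
    apply IsClosed.measurableSet
    exact isClosed_le continuous_const (by fun_prop)
  have hui : IntegrableOn u K := hu.continuousOn.integrableOn_compact hK
  set f : ℝ → ℝ := fun θ => ∫ x in K, (H θ).indicator u x with hf
  have hfe : ∀ θ, f θ = ∫ x in K ∩ H θ, u x := fun θ => by
    rw [hf]; simp only
    rw [setIntegral_indicator (hHm θ)]
  have hnull : ∀ θ, ∀ᵐ x ∂(volume.restrict K), cos θ * (x i - q) + sin θ * (x j - r) ≠ 0 := by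
    intro θ
    apply ae_restrict_of_ae
    rw [ae_iff]
    simpa using hyperplane_null hij (cos_sq_add_sin_sq θ) q r
  have hfc : Continuous f := by
    rw [continuous_iff_continuousAt]
    intro θ
    apply tendsto_integral_filter_of_dominated_convergence (fun x => |u x|)
    · exact Eventually.of_forall fun θ' => (hu.aestronglyMeasurable).indicator (hHm θ')
    · refine Eventually.of_forall fun θ' => Eventually.of_forall fun x => ?_
      rw [← norm_eq_abs]
      exact norm_indicator_le_norm_self _ _
    · exact hui.abs
    · filter_upwards [hnull θ] with x hx
      apply tendsto_const_nhds.congr'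
      have hc : Continuous fun θ => cos θ * (x i - q) + sin θ * (x j - r) := by fun_prop
      rcases lt_or_gt_of_ne hx with h | h
      · filter_upwards [hc.continuousAt.eventually (gt_mem_nhds h)] with θ' h'
        have m1 : x ∉ H θ := not_le.2 h
        have m2 : x ∉ H θ' := not_le.2 h'
        simp [m1, m2]
      · filter_upwards [hc.continuousAt.eventually (lt_mem_nhds h)] with θ' h'
        have m1 : x ∈ H θ := le_of_lt h
        have m2 : x ∈ H θ' := le_of_lt h'
        simp [m1, m2]
  have hneg : ∀ θ, f (θ + π) = - f θ := by
    intro θ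
    have : f θ + f (θ + π) = ∫ x in K, u x := by
      rw [hf]; simp only
      rw [← integral_add (hui.indicator (hHm _)) (hui.indicator (hHm _))]
      apply integral_congr_ae
      filter_upwards [hnull θ] with x hx
      rcases lt_or_gt_of_ne hx with h | h
      · have m1 : x ∉ H θ := not_le.2 h
        have m2 : x ∈ H (θ + π) := by
          simp only [hH, Set.mem_ofPred_eq, cos_add_pi, sin_add_pi]; linarith
        simp [m1, m2]
      · have m1 : x ∈ H θ := le_of_lt h
        have m2 : x ∉ H (θ + π) := by
          simp only [hH, Set.mem_ofPred_eq, cos_add_pi, sin_add_pi]; linarith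
        simp [m1, m2]
    linarith
  have hz : ∃ θ, f θ = 0 := by
    have h1 := hneg 0
    rcases le_total (f 0) 0 with h | h
    · exact mem_range_of_exists_le_of_exists_ge hfc ⟨0, h⟩ ⟨0 + π, by linarith⟩
    · exact mem_range_of_exists_le_of_exists_ge hfc ⟨0 + π, by linarith⟩ ⟨0, h⟩
  obtain ⟨θ, hθ⟩ := hz
  refine ⟨cos θ, sin θ, cos_sq_add_sin_sq θ, ?_, ?_⟩
  · exact (hfe θ).symm.trans hθ
  · have := hneg θ
    rw [hθ, hfe, neg_zero] at this
    simpa only [hH, cos_add_pi, sin_add_pi] using this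

lemma cut_split {d : ℕ} {i j : Fin d} (hij : i ≠ j) {a b : ℝ} (hab : a ^ 2 + b ^ 2 = 1) (q r : ℝ) {K : Set (Euc d)} (hK : IsCompact K)
    {g : Euc d → ℝ} (hg : Continuous g) :
    ∫ x in K, g x = (∫ x in K ∩ {x | 0 ≤ a * (x i - q) + b * (x j - r)}, g x) +
      ∫ x in K ∩ {x | 0 ≤ (-a) * (x i - q) + (-b) * (x j - r)}, g x := by
  have hgi : IntegrableOn g K := hg.continuousOn.integrableOn_compact hK
  have m : ∀ a b : ℝ, MeasurableSet {x : Euc d | 0 ≤ a * (x i - q) + b * (x j - r)} := fun a b =>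
    (isClosed_le continuous_const (by fun_prop)).measurableSet
  rw [← setIntegral_indicator (m _ _), ← setIntegral_indicator (m _ _),
    ← integral_add (hgi.indicator (m _ _)) (hgi.indicator (m _ _))]
  apply integral_congr_ae
  have hnull : ∀ᵐ x ∂(volume.restrict K), a * (x i - q) + b * (x j - r) ≠ 0 := by
    apply ae_restrict_of_ae
    rw [ae_iff]
    simpa using hyperplane_null hij hab q r
  filter_upwards [hnull] with x hx
  simp only [Set.indicator, Set.mem_ofPred_eq]
  rcases lt_or_gt_of_ne hx with h | h
  · rw [if_neg (by linarith), if_pos (by linarith)]; simp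
  · rw [if_pos (by linarith), if_neg (by linarith)]; simp

/-- the good bodies in the localization procedure -/
def GoodBody {d : ℕ} (u g : Euc d → ℝ) (K : Set (Euc d)) : Prop :=
  IsCompact K ∧ Convex ℝ K ∧ ∫ x in K, u x = 0 ∧ ∫ x in K, g x < 0

lemma good_step {d : ℕ} {u g : Euc d → ℝ} (hu : Continuous u) (hg : Continuous g) {K : Set (Euc d)}
    (hK : GoodBody u g K) (i j : Fin d) (q r : ℝ) :
    ∃ K', K' ⊆ K ∧ GoodBody u g K' ∧ (i ≠ j → ∃ a b : ℝ, a ^ 2 + b ^ 2 = 1 ∧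
      ∀ x ∈ K', 0 ≤ a * (x i - q) + b * (x j - r)) := by
  by_cases hij : i = j
  · exact ⟨K, subset_rfl, hK, fun h => absurd hij h⟩
  obtain ⟨a, b, hab, h1, h2⟩ := cut_exists hij q r hK.1 hu hK.2.2.1
  have hs := cut_split hij hab q r hK.1 hg
  have hneg := hK.2.2.2
  have hcl : ∀ a b : ℝ, IsClosed {x : Euc d | 0 ≤ a * (x i - q) + b * (x j - r)} := fun a b =>
    isClosed_le continuous_const (by fun_prop)
  have hcv : ∀ a b : ℝ, Convex ℝ {x : Euc d | 0 ≤ a * (x i - q) + b * (x j - r)} := by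
    intro a b x hx y hy s t hs ht hst
    simp only [Set.mem_ofPred_eq, PiLp.add_apply, PiLp.smul_apply, smul_eq_mul] at *
    have : a * (s * x i + t * y i - q) + b * (s * x j + t * y j - r) =
      s * (a * (x i - q) + b * (x j - r)) + t * (a * (y i - q) + b * (y j - r)) := by
      have : s = 1 - t := by linarith
      subst this; ring
    rw [this]; positivity
  by_cases hn : ∫ x in K ∩ {x | 0 ≤ a * (x i - q) + b * (x j - r)}, g x < 0
  · exact ⟨_, Set.inter_subset_left, ⟨hK.1.inter_right (hcl _ _), hK.2.1.inter (hcv _ _), h1, hn⟩,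
      fun _ => ⟨a, b, hab, fun x hx => hx.2⟩⟩
  · exact ⟨_, Set.inter_subset_left, ⟨hK.1.inter_right (hcl _ _), hK.2.1.inter (hcv _ _), h2, by linarith⟩,
      fun _ => ⟨-a, -b, by linarith [neg_sq a, neg_sq b], fun x hx => hx.2⟩⟩

lemma minor_zero {d : ℕ} {S : Set (Euc d)} (i j : Fin d)
    (h : ∀ q r : ℚ, ∃ a b : ℝ, a ^ 2 + b ^ 2 = 1 ∧ ∀ x ∈ S, 0 ≤ a * (x i - q) + b * (x j - r))
    {x y z : Euc d} (hx : x ∈ S) (hy : y ∈ S) (hz : z ∈ S) :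
    (y i - x i) * (z j - x j) = (y j - x j) * (z i - x i) := by
  by_contra hne
  set v1 := y i - x i with hv1
  set v2 := y j - x j with hv2
  set w1 := z i - x i with hw1
  set w2 := z j - x j with hw2
  set Δ := v1 * w2 - v2 * w1 with hΔ
  have hΔ0 : Δ ≠ 0 := sub_ne_zero.2 hne
  set s : ℝ × ℝ → ℝ := fun p => ((p.1 - x i) * w2 - (p.2 - x j) * w1) / Δ with hs
  set t : ℝ × ℝ → ℝ := fun p => (v1 * (p.2 - x j) - v2 * (p.1 - x i)) / Δ with ht
  have ho : IsOpen {p : ℝ × ℝ | 0 < s p ∧ 0 < t p ∧ s p + t p < 1} := by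
    have cs : Continuous s := by fun_prop
    have ct : Continuous t := by fun_prop
    exact (isOpen_lt continuous_const cs).inter ((isOpen_lt continuous_const ct).inter
      (isOpen_lt (cs.add ct) continuous_const))
  have hdense : DenseRange (Prod.map ((↑) : ℚ → ℝ) ((↑) : ℚ → ℝ)) :=
    Rat.denseRange_cast.prodMap Rat.denseRange_cast
  obtain ⟨⟨q, r⟩, hq⟩ := hdense.exists_mem_open ho ⟨(x i + (v1 + w1) / 3, x j + (v2 + w2) / 3), by
    have e1 : s (x i + (v1 + w1) / 3, x j + (v2 + w2) / 3) = 1 / 3 := by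
      simp only [hs]; rw [div_eq_iff hΔ0, hΔ]; ring
    have e2 : t (x i + (v1 + w1) / 3, x j + (v2 + w2) / 3) = 1 / 3 := by
      simp only [ht]; rw [div_eq_iff hΔ0, hΔ]; ring
    simp only [Set.mem_ofPred_eq, e1, e2]; norm_num⟩
  simp only [Prod.map_apply, Set.mem_ofPred_eq] at hq
  obtain ⟨p1, p2, p3⟩ := hq
  obtain ⟨a, b, hab, hl⟩ := h q r
  have lx := hl x hx
  have ly := hl y hy
  have lz := hl z hz
  set S' := s (↑q, ↑r) with hS'
  set T' := t (↑q, ↑r) with hT'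
  have q1 : (q : ℝ) - x i = S' * v1 + T' * w1 := by
    rw [hS', hT']; simp only [hs, ht]; field_simp; rw [hΔ]; ring
  have q2 : (r : ℝ) - x j = S' * v2 + T' * w2 := by
    rw [hS', hT']; simp only [hs, ht]; field_simp; rw [hΔ]; ring
  have ey : a * (y i - q) + b * (y j - r) = (a * (x i - q) + b * (x j - r)) + (a * v1 + b * v2) := by
    rw [hv1, hv2]; ring
  have ez : a * (z i - q) + b * (z j - r) = (a * (x i - q) + b * (x j - r)) + (a * w1 + b * w2) := by
    rw [hw1, hw2]; ring
  set ℓ := a * (x i - q) + b * (x j - r) with hℓ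
  have eℓ : ℓ = - (S' * (a * v1 + b * v2) + T' * (a * w1 + b * w2)) := by
    rw [hℓ]; linear_combination (-a) * q1 - b * q2
  rw [ey] at ly
  rw [ez] at lz
  set V := a * v1 + b * v2
  set W := a * w1 + b * w2
  have hsum : (1 - S' - T') * ℓ + S' * (ℓ + V) + T' * (ℓ + W) = 0 := by
    linear_combination eℓ
  have g1 : 0 ≤ (1 - S' - T') * ℓ := mul_nonneg (by linarith) lx
  have g2 : 0 ≤ S' * (ℓ + V) := mul_nonneg p1.le ly
  have g3 : 0 ≤ T' * (ℓ + W) := mul_nonneg p2.le lz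
  have z1 : ℓ = 0 := by
    have : (1 - S' - T') * ℓ = 0 := by linarith
    exact (mul_eq_zero.1 this).resolve_left (by linarith)
  have z2 : ℓ + V = 0 := by
    have : S' * (ℓ + V) = 0 := by linarith
    exact (mul_eq_zero.1 this).resolve_left (by linarith)
  have z3 : ℓ + W = 0 := by
    have : T' * (ℓ + W) = 0 := by linarith
    exact (mul_eq_zero.1 this).resolve_left (by linarith)
  have hV : a * v1 + b * v2 = 0 := by linarith
  have hW : a * w1 + b * w2 = 0 := by linarith
  have ha : a * Δ = 0 := by rw [hΔ]; linear_combination w2 * hV - v2 * hW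
  have hb : b * Δ = 0 := by rw [hΔ]; linear_combination v1 * hW - w1 * hV
  have ha' := (mul_eq_zero.1 ha).resolve_right hΔ0
  have hb' := (mul_eq_zero.1 hb).resolve_right hΔ0
  rw [ha', hb'] at hab
  norm_num at hab

end Part5

section Part6

lemma GoodBody.nonempty {d : ℕ} {u g : Euc d → ℝ} {K : Set (Euc d)} (h : GoodBody u g K) : K.Nonempty := by
  rw [Set.nonempty_iff_ne_empty]
  rintro rfl
  have := h.2.2.2
  simp at this

lemma localization {m : ℕ} {u g : Euc (m + 1) → ℝ} (hu : Continuous u) (hg : Continuous g)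
    {K : Set (Euc (m + 1))} (hK : GoodBody u g K) {ε : ℝ} (hε : 0 < ε) :
    ∃ C, C ⊆ K ∧ GoodBody u g C ∧ ∃ a e : Euc (m + 1), ‖e‖ = 1 ∧
      ∀ x ∈ C, ‖x - (a + (inner ℝ e (x - a)) • e)‖ < ε := by
  obtain ⟨φ, hφ⟩ := exists_surjective_nat (Fin (m+1) × Fin (m+1) × ℚ × ℚ)
  choose! F hF1 hF2 hF3 using fun (L : Set (Euc (m+1))) (w : Fin (m+1) × Fin (m+1) × ℚ × ℚ)
    (hL : GoodBody u g L) => good_step hu hg hL w.1 w.2.1 w.2.2.1 w.2.2.2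
  let S : ℕ → Set (Euc (m+1)) := fun n => Nat.rec K (fun n L => F L (φ n)) n
  have hS0 : S 0 = K := rfl
  have hSs : ∀ n, S (n+1) = F (S n) (φ n) := fun n => rfl
  have hgood : ∀ n, GoodBody u g (S n) := by
    intro n
    induction n with
    | zero => exact hK
    | succ n ih => rw [hSs]; exact hF2 _ _ ih
  have hanti : Antitone S := antitone_nat_of_succ_le fun n => by
    rw [hSs]; exact hF1 _ _ (hgood n)
  set T := ⋂ n, S n with hT
  have hTne : T.Nonempty := IsCompact.nonempty_iInter_of_directed_nonempty_isCompact_isClosed S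
    (hanti.directed_ge) (fun n => (hgood n).nonempty) (fun n => (hgood n).1)
    (fun n => (hgood n).1.isClosed)
  have hTS : ∀ n, T ⊆ S n := fun n => Set.iInter_subset _ n
  have hminor : ∀ i j : Fin (m+1), ∀ x ∈ T, ∀ y ∈ T, ∀ z ∈ T,
      (y i - x i) * (z j - x j) = (y j - x j) * (z i - x i) := by
    intro i j x hx y hy z hz
    by_cases hij : i = j
    · subst hij; rfl
    refine minor_zero i j ?_ hx hy hz
    intro q r
    obtain ⟨n, hn⟩ := hφ (i, j, q, r)
    have := hF3 (S n) (φ n) (hgood n)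
    rw [hn] at this
    obtain ⟨a, b, hab, h⟩ := this hij
    refine ⟨a, b, hab, fun x hx => h x ?_⟩
    have := hTS (n+1) hx
    rwa [hSs, hn] at this
  obtain ⟨a, ha⟩ := hTne
  have hline : ∃ e : Euc (m+1), ‖e‖ = 1 ∧ ∀ x ∈ T, x = a + (inner ℝ e (x - a)) • e := by
    by_cases hsing : ∃ y ∈ T, y ≠ a
    · obtain ⟨y, hy, hya⟩ := hsing
      have hya' : y - a ≠ 0 := sub_ne_zero.2 hya
      have hn : ‖y - a‖ ≠ 0 := norm_ne_zero_iff.2 hya'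
      set e : Euc (m+1) := ‖y - a‖⁻¹ • (y - a) with he
      have he1 : ‖e‖ = 1 := by
        rw [he, norm_smul, norm_inv, norm_norm, inv_mul_cancel₀ hn]
      refine ⟨e, he1, fun x hx => ?_⟩
      obtain ⟨i, hi⟩ : ∃ i, (y - a) i ≠ 0 := by
        by_contra hcon
        push Not at hcon
        exact hya' (by ext i; simpa using hcon i)
      have hi' : y i - a i ≠ 0 := by simpa using hi
      have hpar : x - a = (((x i - a i) / (y i - a i)) * ‖y - a‖) • e := by
        rw [he, smul_smul, mul_assoc, mul_inv_cancel₀ hn, mul_one]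
        ext j
        have := hminor i j a ha y hy x hx
        simp only [PiLp.sub_apply, PiLp.smul_apply, smul_eq_mul]
        field_simp
        linarith
      have : inner ℝ e (x - a) = ((x i - a i) / (y i - a i)) * ‖y - a‖ := by
        rw [hpar, inner_smul_right, real_inner_self_eq_norm_sq, he1]; ring
      rw [this, ← hpar]; abel
    · push Not at hsing
      refine ⟨EuclideanSpace.single 0 1, by simp, fun x hx => ?_⟩
      rw [hsing x hx]; simp
  obtain ⟨e, he1, hel⟩ := hline
  have hopen : IsOpen {x : Euc (m+1) | ‖x - (a + (inner ℝ e (x - a)) • e)‖ < ε} :=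
    isOpen_lt (by fun_prop) continuous_const
  obtain ⟨n, hn⟩ := exists_subset_nhds_of_isCompact (V := S) (hanti.directed_ge) (fun n => (hgood n).1)
    (U := {x : Euc (m+1) | ‖x - (a + (inner ℝ e (x - a)) • e)‖ < ε}) (fun x hx => hopen.mem_nhds (by
      show ‖x - (a + (inner ℝ e (x - a)) • e)‖ < ε
      rw [← hel x hx]; simpa using hε))
  exact ⟨S n, hS0 ▸ hanti (Nat.zero_le n), hgood n, a, e, he1, fun x hx => hn hx⟩

lemma unif_near {d : ℕ} {F : Euc d → ℝ} (hF : Continuous F) {K : Set (Euc d)} (hK : IsCompact K)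
    {η : ℝ} (hη : 0 < η) : ∃ ε > 0, ∀ x ∈ K, ∀ y, ‖x - y‖ < ε → |F x - F y| < η := by
  have := hK.uniformContinuousAt_of_continuousAt F (fun x _ => hF.continuousAt) (Metric.dist_mem_uniformity hη)
  rw [Metric.mem_uniformity_dist] at this
  obtain ⟨ε, hε, h⟩ := this
  refine ⟨ε, hε, fun x hx y hxy => ?_⟩
  have := h (a := x) (b := y) (by rwa [dist_eq_norm]) hx
  simpa [Real.dist_eq] using this

/-- Payne–Weinberger inequality on compact convex sets. -/
lemma pw_compact {m : ℕ} {u : Euc (m + 1) → ℝ} (hu : ContDiff ℝ 1 u) {K : Set (Euc (m + 1))}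
    (hK : IsCompact K) (hconv : Convex ℝ K) {D k : ℝ} (hk : 0 < k) (hkD : k * D ≤ π)
    (hD : ∀ x ∈ K, ∀ y ∈ K, ‖x - y‖ ≤ D) (h0 : ∫ x in K, u x = 0) :
    k ^ 2 * ∫ x in K, u x ^ 2 ≤ ∫ x in K, ‖fderiv ℝ u x‖ ^ 2 := by
  have huc : Continuous u := hu.continuous
  have hfc : Continuous (fderiv ℝ u) := hu.continuous_fderiv (by simp)
  by_contra hcon
  push Not at hcon
  have int : ∀ {C : Set (Euc (m+1))} {F : Euc (m+1) → ℝ}, IsCompact C → Continuous F → IntegrableOn F C :=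
    fun hC hF => hF.continuousOn.integrableOn_compact hC
  set Δ := k ^ 2 * (∫ x in K, u x ^ 2) - ∫ x in K, ‖fderiv ℝ u x‖ ^ 2 with hΔ
  have hΔpos : 0 < Δ := by linarith
  have hMK : 0 ≤ volume.real K := measureReal_nonneg
  set δ := Δ / (volume.real K + 1) with hδ
  have hδpos : 0 < δ := by positivity
  have hδK : δ * volume.real K < Δ := by
    rw [hδ, div_mul_eq_mul_div, div_lt_iff₀ (by positivity)]; nlinarith
  set g : Euc (m+1) → ℝ := fun x => ‖fderiv ℝ u x‖ ^ 2 - k ^ 2 * u x ^ 2 + δ with hg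
  have hgc : Continuous g := by fun_prop
  have hgint : ∀ {C : Set (Euc (m+1))}, IsCompact C → ∫ x in C, g x =
      (∫ x in C, ‖fderiv ℝ u x‖ ^ 2) - k ^ 2 * (∫ x in C, u x ^ 2) + δ * volume.real C := by
    intro C hC
    have i1 := int hC (F := fun x => ‖fderiv ℝ u x‖ ^ 2) (by fun_prop)
    have i2 := int hC (F := fun x => k ^ 2 * u x ^ 2) (by fun_prop)
    have i3 := int hC (F := fun x => δ) (by fun_prop)
    have e1 : ∫ x in C, g x = (∫ x in C, (‖fderiv ℝ u x‖ ^ 2 - k ^ 2 * u x ^ 2)) + ∫ x in C, δ :=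
      integral_add (i1.sub i2) i3
    rw [e1, integral_sub i1 i2, integral_const_mul]
    simp [mul_comm]
  have hgood : GoodBody u g K := ⟨hK, hconv, h0, by rw [hgint hK]; linarith⟩
  set η := min 1 (δ / (1 + 2 * k ^ 2)) with hη
  have hηpos : 0 < η := by positivity
  have hη1 : η ≤ 1 := min_le_left _ _
  have hη2 : η * (1 + 2 * k ^ 2) ≤ δ := by
    rw [← le_div_iff₀ (by positivity)]; exact min_le_right _ _
  obtain ⟨ε1, hε1, H1⟩ := unif_near huc hK hηpos
  obtain ⟨ε2, hε2, H2⟩ := unif_near (F := fun x => u x ^ 2) (by fun_prop) hK hηpos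
  obtain ⟨ε3, hε3, H3⟩ := unif_near (F := fun x => ‖fderiv ℝ u x‖ ^ 2) (by fun_prop) hK hηpos
  obtain ⟨C, hCK, hCg, a, e, he, hline⟩ := localization huc hgc hgood (ε := min ε1 (min ε2 ε3)) (by positivity)
  have hC := hCg.1
  set P : Euc (m+1) → Euc (m+1) := fun x => a + (inner ℝ e (x - a)) • e with hP
  have hPc : Continuous P := by fun_prop
  obtain ⟨p, hp0, hpi, hps, hplc, hpint⟩ := exists_marginal e he hC hCg.2.1
  set v : ℝ → ℝ := fun t => u (a + (t - inner ℝ e a) • e) with hv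
  set v' : ℝ → ℝ := fun t => fderiv ℝ u (a + (t - inner ℝ e a) • e) e with hv'
  have hvd : ∀ t, HasDerivAt v (v' t) t := by
    intro t
    have h1 : HasDerivAt (fun t : ℝ => a + (t - inner ℝ e a) • e) e t := by
      have := (((hasDerivAt_id t).sub_const (inner ℝ e a)).smul_const e).const_add a
      simpa using this
    exact ((hu.differentiable (by simp)) _).hasFDerivAt.comp_hasDerivAt t h1
  have hv'c : Continuous v' := by
    have : Continuous fun t : ℝ => a + (t - inner ℝ e a) • e := by fun_prop
    exact (hfc.comp this).clm_apply continuous_const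
  have hvc : Continuous v := by fun_prop
  have hvP : ∀ x, v (inner ℝ e x) = u (P x) := fun x => by simp [hv, hP, inner_sub_right]
  have hv'P : ∀ x, v' (inner ℝ e x) = fderiv ℝ u (P x) e := fun x => by simp [hv', hP, inner_sub_right]
  have J0 : volume.real C = ∫ t, p t := by
    have := hpint (fun _ => 1) continuous_const
    simpa using this
  have J1 : ∫ x in C, u (P x) = ∫ t, v t * p t := by
    rw [← hpint v hvc]; simp only [hvP]
  have J2 : ∫ x in C, u (P x) ^ 2 = ∫ t, v t ^ 2 * p t := by
    rw [← hpint (fun t => v t ^ 2) (by fun_prop)]; simp only [hvP]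
  have J3 : ∫ x in C, (fderiv ℝ u (P x) e) ^ 2 = ∫ t, v' t ^ 2 * p t := by
    rw [← hpint (fun t => v' t ^ 2) (by fun_prop)]; simp only [hv'P]
  set M := volume.real C with hM
  have hMpos : 0 < M := by
    rcases (measureReal_nonneg (μ := volume) (s := C)).eq_or_lt with h | h
    · exfalso
      have h' : volume C = 0 := by
        rw [eq_comm, measureReal_eq_zero_iff hC.measure_lt_top.ne] at h; exact h
      have := hCg.2.2.2
      rw [setIntegral_measure_zero _ h'] at this
      exact lt_irrefl _ this
    · exact h
  have hmain := oned_logconcave hk hkD hp0 hpi (J0 ▸ hMpos) (fun s t hs ht => by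
    obtain ⟨x, hx, rfl⟩ := hps s hs
    obtain ⟨y, hy, rfl⟩ := hps t ht
    rw [← inner_sub_right]
    refine (abs_real_inner_le_norm _ _).trans ?_
    rw [he, one_mul]; exact hD x (hCK hx) y (hCK hy)) hplc hvd hv'c
  rw [← J0, ← J1, ← J2, ← J3] at hmain
  have hlin : ∀ {x}, x ∈ C → ‖x - P x‖ < ε1 ∧ ‖x - P x‖ < ε2 ∧ ‖x - P x‖ < ε3 := fun {x} hx => by
    have := hline x hx
    simpa [lt_min_iff] using this
  have hconst : ∫ x in C, η = η * M := by simp [mul_comm, hM]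
  have iη := int hC (F := fun x => η) (by fun_prop)
  have A1 : |∫ x in C, u (P x)| ≤ η * M := by
    have i1 := int hC (F := fun x => u (P x)) (by fun_prop)
    have i2 := int hC huc
    have : ∫ x in C, u (P x) = ∫ x in C, (u (P x) - u x) := by
      rw [integral_sub i1 i2, hCg.2.2.1, sub_zero]
    rw [this, ← Real.norm_eq_abs]
    refine norm_setIntegral_le_of_norm_le_const hC.measure_lt_top (fun x hx => ?_)
    rw [Real.norm_eq_abs, abs_sub_comm]
    exact (H1 x (hCK hx) _ (hlin hx).1).le
  have A2 : (∫ x in C, u x ^ 2) - η * M ≤ ∫ x in C, u (P x) ^ 2 := by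
    have i1 := int hC (F := fun x => u (P x) ^ 2) (by fun_prop)
    have i2 := int hC (F := fun x => u x ^ 2) (by fun_prop)
    rw [← hconst, ← integral_sub i2 iη]
    refine setIntegral_mono_on (i2.sub iη) i1 hC.measurableSet fun x hx => ?_
    have := (abs_lt.1 (H2 x (hCK hx) _ (hlin hx).2.1)).2
    linarith
  have A3 : ∫ x in C, (fderiv ℝ u (P x) e) ^ 2 ≤ (∫ x in C, ‖fderiv ℝ u x‖ ^ 2) + η * M := by
    have i1 := int hC (F := fun x => (fderiv ℝ u (P x) e) ^ 2)
      (((hfc.comp hPc).clm_apply continuous_const).pow 2)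
    have i2 := int hC (F := fun x => ‖fderiv ℝ u x‖ ^ 2) (by fun_prop)
    rw [← hconst, ← integral_add i2 iη]
    refine setIntegral_mono_on i1 (i2.add iη) hC.measurableSet fun x hx => ?_
    have := (abs_lt.1 (H3 x (hCK hx) _ (hlin hx).2.2)).1
    have h2 : (fderiv ℝ u (P x) e) ^ 2 ≤ ‖fderiv ℝ u (P x)‖ ^ 2 := by
      rw [← sq_abs, ← Real.norm_eq_abs]
      have := (fderiv ℝ u (P x)).le_opNorm e
      rw [he, mul_one] at this
      gcongr
    linarith
  have hneg := hCg.2.2.2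
  rw [hgint hC] at hneg
  have A1' : (∫ x in C, u (P x)) ^ 2 ≤ (η * M) ^ 2 := sq_le_sq' (abs_le.1 A1).1 (abs_le.1 A1).2
  set U := ∫ x in C, u x ^ 2
  set G := ∫ x in C, ‖fderiv ℝ u x‖ ^ 2
  have k2 : 0 ≤ k ^ 2 := sq_nonneg k
  have hle : k ^ 2 * (M * (U - η * M) - (η * M) ^ 2) ≤ M * (G + η * M) := by
    refine le_trans ?_ (hmain.trans ?_)
    · apply mul_le_mul_of_nonneg_left _ k2
      have := mul_le_mul_of_nonneg_left A2 hMpos.le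
      linarith
    · exact mul_le_mul_of_nonneg_left A3 hMpos.le
  have hle2 : M * (k ^ 2 * (U - η * M - η ^ 2 * M)) ≤ M * (G + η * M) := by linarith
  have hle3 := le_of_mul_le_mul_left hle2 hMpos
  have : η ^ 2 ≤ η := by nlinarith
  have h5 : k ^ 2 * (η ^ 2 * M) ≤ k ^ 2 * (η * M) := by gcongr
  have h6 : η * (1 + 2 * k ^ 2) * M ≤ δ * M := by gcongr
  linarith

lemma pw_domain {m : ℕ} {u : Euc (m + 1) → ℝ} (hu : ContDiff ℝ 1 u) {Ω : Set (Euc (m + 1))}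
    (hb : Bornology.IsBounded Ω) (hconv : Convex ℝ Ω) {D k : ℝ} (hk : 0 < k) (hkD : k * D ≤ π)
    (hD : Metric.diam Ω ≤ D) (h0 : ∫ x in Ω, u x = 0) :
    k ^ 2 * ∫ x in Ω, u x ^ 2 ≤ ∫ x in Ω, ‖fderiv ℝ u x‖ ^ 2 := by
  have hae : (closure Ω : Set (Euc (m+1))) =ᵐ[volume] Ω := by
    have h1 : volume (closure Ω \ Ω) = 0 := by
      refine measure_mono_null ?_ (hconv.addHaar_frontier volume)
      exact fun x hx => ⟨hx.1, fun h => hx.2 (interior_subset h)⟩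
    exact (LE.le.eventuallyLE (subset_closure (s := Ω))).antisymm (ae_le_set.2 h1) |>.symm
  rw [← setIntegral_congr_set hae] at h0
  rw [← setIntegral_congr_set hae, ← setIntegral_congr_set hae]
  refine pw_compact hu hb.isCompact_closure hconv.closure hk hkD (fun x hx y hy => ?_) h0
  rw [← dist_eq_norm]
  refine le_trans ?_ hD
  rw [← Metric.diam_closure]
  exact Metric.dist_le_diam_of_mem hb.closure hx hy

end Part6

section Part7

lemma int_bdd {d : ℕ} {Ω : Set (Euc d)} (hb : Bornology.IsBounded Ω) {F : Euc d → ℝ} (hF : Continuous F) :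
    IntegrableOn F Ω :=
  (hF.continuousOn.integrableOn_compact hb.isCompact_closure).mono_set subset_closure

lemma int_sq_pos {d : ℕ} {Ω : Set (Euc d)} (ho : IsOpen Ω) (hb : Bornology.IsBounded Ω) {F : Euc d → ℝ}
    (hF : Continuous F) {x : Euc d} (hx : x ∈ Ω) (hFx : F x ≠ 0) : 0 < ∫ x in Ω, F x ^ 2 := by
  rw [setIntegral_pos_iff_support_of_nonneg_ae (Eventually.of_forall fun x => sq_nonneg _)
    (int_bdd hb (by fun_prop))]
  apply IsOpen.measure_pos
  · exact ((hF.pow 2).isOpen_support).inter ho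
  · exact ⟨x, by simpa using hFx, hx⟩

lemma rayleigh_congr {d : ℕ} {Ω : Set (Euc d)} (ho : IsOpen Ω) {u w : Euc d → ℝ} (h : Set.EqOn u w Ω) :
    rayleigh Ω u = rayleigh Ω w := by
  unfold rayleigh
  congr 1
  · refine setIntegral_congr_fun ho.measurableSet fun x hx => ?_
    have : u =ᶠ[nhds x] w := Filter.eventuallyEq_of_mem (ho.mem_nhds hx) h
    simp only [this.fderiv_eq]
  · refine setIntegral_congr_fun ho.measurableSet fun x hx => ?_
    simp only [h hx]

lemma rayleigh_nonneg {d : ℕ} (Ω : Set (Euc d)) (u : Euc d → ℝ) : 0 ≤ rayleigh Ω u := by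
  unfold rayleigh
  apply div_nonneg <;> exact integral_nonneg fun x => sq_nonneg _

lemma rayleigh_sup_ge {m : ℕ} {Ω : Set (Euc (m+1))} (h : IsConvexDomain Ω) {k : ℝ} (hk : 0 < k)
    (hkD : k * Metric.diam Ω ≤ π) (V : Submodule ℝ (Euc (m+1) → ℝ)) (hV : ∀ u ∈ V, ContDiff ℝ (⊤ : ℕ∞) u)
    (hrank : Module.finrank ℝ (V.map (LinearMap.funLeft ℝ ℝ ((↑) : Ω → Euc (m+1)))) = 1 + 1) :
    k ^ 2 ≤ sSup { r : ℝ | ∃ u ∈ V, (0 < ∫ x in Ω, (u x) ^ 2) ∧ r = rayleigh Ω u } := by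
  obtain ⟨hne, ho, hb, hconv⟩ := h
  set R := LinearMap.funLeft ℝ ℝ ((↑) : Ω → Euc (m+1)) with hR
  haveI : Module.Finite ℝ (V.map R) := Module.finite_of_finrank_pos (by omega)
  let b : Module.Basis (Fin 2) ℝ (V.map R) := Module.finBasisOfFinrankEq ℝ _ hrank
  obtain ⟨u0, hu0, hb0⟩ := (b 0).2
  obtain ⟨u1, hu1, hb1⟩ := (b 1).2
  have c0 : ContDiff ℝ 1 u0 := (hV u0 hu0).of_le (by exact_mod_cast le_top)
  have c1 : ContDiff ℝ 1 u1 := (hV u1 hu1).of_le (by exact_mod_cast le_top)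
  have cc0 := c0.continuous
  have cc1 := c1.continuous
  have df0 : Continuous (fderiv ℝ u0) := c0.continuous_fderiv (by simp)
  have df1 : Continuous (fderiv ℝ u1) := c1.continuous_fderiv (by simp)
  let w : ℝ → ℝ → Euc (m+1) → ℝ := fun α β => α • u0 + β • u1
  have hwx : ∀ α β x, w α β x = α * u0 x + β * u1 x := fun α β x => by simp [w]
  have hwV : ∀ α β, w α β ∈ V := fun α β => V.add_mem (V.smul_mem _ hu0) (V.smul_mem _ hu1)
  have hwc : ∀ α β, ContDiff ℝ 1 (w α β) := fun α β => (c0.const_smul α).add (c1.const_smul β)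
  have hpos : ∀ α β, (α ≠ 0 ∨ β ≠ 0) → 0 < ∫ x in Ω, w α β x ^ 2 := by
    intro α β hab
    have : ∃ x ∈ Ω, w α β x ≠ 0 := by
      by_contra hcon
      push Not at hcon
      have hz : α • b 0 + β • b 1 = 0 := by
        apply Subtype.ext
        simp only [Submodule.coe_add, Submodule.coe_smul, ← hb0, ← hb1, Submodule.coe_zero]
        funext x
        have := hcon x x.2
        simpa [w, hR, LinearMap.funLeft_apply] using this
      have hli := b.linearIndependent
      rw [Fintype.linearIndependent_iff] at hli
      have := hli ![α, β] (by simpa [Fin.sum_univ_two] using hz)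
      rcases hab with h | h
      · exact h (by simpa using this 0)
      · exact h (by simpa using this 1)
    obtain ⟨x, hx, hxw⟩ := this
    exact int_sq_pos ho hb (hwc α β).continuous hx hxw
  have hrep : ∀ u ∈ V, ∃ α β, Set.EqOn u (w α β) Ω := by
    intro u hu
    have hmem : R u ∈ V.map R := Submodule.mem_map_of_mem hu
    refine ⟨b.repr ⟨R u, hmem⟩ 0, b.repr ⟨R u, hmem⟩ 1, fun x hx => ?_⟩
    have := congrArg Subtype.val (b.sum_repr ⟨R u, hmem⟩)
    simp only [Fin.sum_univ_two, Submodule.coe_add, Submodule.coe_smul, ← hb0, ← hb1] at this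
    have := congrFun this ⟨x, hx⟩
    simp only [Pi.add_apply, Pi.smul_apply, hR, LinearMap.funLeft_apply, smul_eq_mul] at this
    rw [hwx, ← this]
  set P := ∫ x in Ω, u0 x ^ 2 with hP
  set Q := ∫ x in Ω, u0 x * u1 x with hQ
  set S := ∫ x in Ω, u1 x ^ 2 with hS
  have hform : ∀ α β, ∫ x in Ω, w α β x ^ 2 = P * α ^ 2 + 2 * Q * α * β + S * β ^ 2 := by
    intro α β
    have i1 := int_bdd hb (F := fun x => α ^ 2 * u0 x ^ 2) (by fun_prop)
    have i2 := int_bdd hb (F := fun x => (2 * α * β) * (u0 x * u1 x)) (by fun_prop)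
    have i3 := int_bdd hb (F := fun x => β ^ 2 * u1 x ^ 2) (by fun_prop)
    have : ∀ x, w α β x ^ 2 = α ^ 2 * u0 x ^ 2 + (2 * α * β) * (u0 x * u1 x) + β ^ 2 * u1 x ^ 2 := by
      intro x; rw [hwx]; ring
    simp only [this]
    have e1 : ∫ x in Ω, (α ^ 2 * u0 x ^ 2 + (2 * α * β) * (u0 x * u1 x) + β ^ 2 * u1 x ^ 2) =
      (∫ x in Ω, (α ^ 2 * u0 x ^ 2 + (2 * α * β) * (u0 x * u1 x))) + ∫ x in Ω, β ^ 2 * u1 x ^ 2 :=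
      integral_add (i1.add i2) i3
    rw [e1, integral_add i1 i2, integral_const_mul, integral_const_mul, integral_const_mul]
    ring
  have hPp : 0 < P := by have := hpos 1 0 (by simp); rw [hform] at this; simpa using this
  have hSp : 0 < S := by have := hpos 0 1 (by simp); rw [hform] at this; simpa using this
  have hdet : 0 < P * S - Q ^ 2 := by
    have := hpos (-Q) P (Or.inr hPp.ne')
    rw [hform] at this
    have h2 : 0 < P * (P * S - Q ^ 2) := by nlinarith
    exact (pos_iff_pos_of_mul_pos h2).1 hPp
  set c := (P * S - Q ^ 2) / (P + S) with hc
  have hcp : 0 < c := by positivity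
  have hcoer : ∀ α β, c * (α ^ 2 + β ^ 2) ≤ ∫ x in Ω, w α β x ^ 2 := by
    intro α β
    rw [hform, hc, div_mul_eq_mul_div, div_le_iff₀ (by positivity)]
    nlinarith [sq_nonneg (P * α + Q * β), sq_nonneg (Q * α + S * β)]
  set N0 := ∫ x in Ω, ‖fderiv ℝ u0 x‖ ^ 2 with hN0
  set N1 := ∫ x in Ω, ‖fderiv ℝ u1 x‖ ^ 2 with hN1
  have hN0p : 0 ≤ N0 := integral_nonneg fun x => sq_nonneg _
  have hN1p : 0 ≤ N1 := integral_nonneg fun x => sq_nonneg _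
  have hnum : ∀ α β, ∫ x in Ω, ‖fderiv ℝ (w α β) x‖ ^ 2 ≤ 2 * (α ^ 2 * N0 + β ^ 2 * N1) := by
    intro α β
    have i1 := int_bdd hb (F := fun x => (2 * α ^ 2) * ‖fderiv ℝ u0 x‖ ^ 2) (by fun_prop)
    have i2 := int_bdd hb (F := fun x => (2 * β ^ 2) * ‖fderiv ℝ u1 x‖ ^ 2) (by fun_prop)
    have hcf : Continuous (fderiv ℝ (w α β)) := (hwc α β).continuous_fderiv (by simp)
    have i3 := int_bdd hb (F := fun x => ‖fderiv ℝ (w α β) x‖ ^ 2) (by fun_prop)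
    have e : 2 * (α ^ 2 * N0 + β ^ 2 * N1) = ∫ x in Ω, ((2 * α ^ 2) * ‖fderiv ℝ u0 x‖ ^ 2 + (2 * β ^ 2) * ‖fderiv ℝ u1 x‖ ^ 2) := by
      rw [integral_add i1 i2, integral_const_mul, integral_const_mul]; ring
    rw [e]
    refine integral_mono i3 (i1.add i2) fun x => ?_
    have hf : fderiv ℝ (w α β) x = α • fderiv ℝ u0 x + β • fderiv ℝ u1 x := by
      have d0 := (c0.differentiable (by simp)) x
      have d1 := (c1.differentiable (by simp)) x
      exact ((d0.hasFDerivAt.const_smul α).add (d1.hasFDerivAt.const_smul β)).fderiv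
    have hn : ‖fderiv ℝ (w α β) x‖ ≤ |α| * ‖fderiv ℝ u0 x‖ + |β| * ‖fderiv ℝ u1 x‖ := by
      rw [hf]; refine (norm_add_le _ _).trans ?_
      rw [norm_smul, norm_smul, Real.norm_eq_abs, Real.norm_eq_abs]
    have h2 : ‖fderiv ℝ (w α β) x‖ ^ 2 ≤ (|α| * ‖fderiv ℝ u0 x‖ + |β| * ‖fderiv ℝ u1 x‖) ^ 2 := by gcongr
    simp only [Pi.add_apply]
    have h3 := sq_nonneg (|α| * ‖fderiv ℝ u0 x‖ - |β| * ‖fderiv ℝ u1 x‖)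
    rw [← sq_abs α, ← sq_abs β]
    nlinarith
  have hbdd : BddAbove { r : ℝ | ∃ u ∈ V, (0 < ∫ x in Ω, (u x) ^ 2) ∧ r = rayleigh Ω u } := by
    refine ⟨2 * (N0 + N1) / c, ?_⟩
    rintro r ⟨u, hu, hup, rfl⟩
    obtain ⟨α, β, hab⟩ := hrep u hu
    rw [rayleigh_congr ho hab]
    have hup' : 0 < ∫ x in Ω, w α β x ^ 2 := by
      have : ∫ x in Ω, u x ^ 2 = ∫ x in Ω, w α β x ^ 2 :=
        setIntegral_congr_fun ho.measurableSet fun x hx => by simp only [hab hx]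
      rwa [← this]
    unfold rayleigh
    rw [div_le_div_iff₀ hup' hcp]
    have h1 := hnum α β
    have h2 := hcoer α β
    calc _ ≤ 2 * (α ^ 2 * N0 + β ^ 2 * N1) * c := by gcongr
      _ ≤ 2 * (N0 + N1) * (c * (α ^ 2 + β ^ 2)) := by
        have : 0 ≤ c * (α ^ 2 * N1 + β ^ 2 * N0) := by positivity
        nlinarith
      _ ≤ _ := by gcongr
  have hmz : ∃ α β : ℝ, (α ≠ 0 ∨ β ≠ 0) ∧ ∫ x in Ω, w α β x = 0 := by
    have hl : ∀ α β, ∫ x in Ω, w α β x = α * (∫ x in Ω, u0 x) + β * ∫ x in Ω, u1 x := by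
      intro α β
      simp only [hwx]
      rw [integral_add (int_bdd hb (by fun_prop)) (int_bdd hb (by fun_prop)), integral_const_mul,
        integral_const_mul]
    by_cases h0 : ∫ x in Ω, u0 x = 0
    · exact ⟨1, 0, by simp, by rw [hl, h0]; ring⟩
    · exact ⟨-∫ x in Ω, u1 x, ∫ x in Ω, u0 x, Or.inr h0, by rw [hl]; ring⟩
  obtain ⟨α, β, hab, hz⟩ := hmz
  have hpw := pw_domain (hwc α β) hb hconv hk hkD le_rfl hz
  have hp := hpos α β hab
  refine le_trans ?_ (le_csSup hbdd ⟨w α β, hwV α β, hp, rfl⟩)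
  unfold rayleigh
  rwa [le_div_iff₀ hp]

end Part7

section Part8

lemma smooth_ramp {δ : ℝ} (hδ : 0 < δ) : ∃ g g' : ℝ → ℝ, ContDiff ℝ (⊤ : ℕ∞) g ∧
    (∀ t, HasDerivAt g (g' t) t) ∧ (∀ t, |g' t| ≤ 1) ∧ (∀ t, 0 ≤ t → g t = 0 ∧ g' t = 0) ∧
    (∀ t, 0 ≤ g t) ∧ ∀ t, -t - δ ≤ g t := by
  set f : ℝ → ℝ := fun s => smoothTransition (-s / δ) with hf
  have hfs : ContDiff ℝ (⊤ : ℕ∞) f := smoothTransition.contDiff.comp (by fun_prop)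
  have hfc : Continuous f := hfs.continuous
  have hf0 : ∀ s, 0 ≤ f s := fun s => smoothTransition.nonneg _
  have hf1 : ∀ s, f s ≤ 1 := fun s => smoothTransition.le_one _
  have hfz : ∀ s, 0 ≤ s → f s = 0 := fun s hs =>
    smoothTransition.zero_of_nonpos (div_nonpos_of_nonpos_of_nonneg (by linarith) hδ.le)
  have hfo : ∀ s, s ≤ -δ → f s = 1 := fun s hs =>
    smoothTransition.one_of_one_le (by rw [le_div_iff₀ hδ]; linarith)
  set g : ℝ → ℝ := fun t => ∫ s in t..0, f s with hg
  have hgd : ∀ t, HasDerivAt g (-f t) t := fun t =>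
    intervalIntegral.integral_hasDerivAt_left (hfc.intervalIntegrable _ _)
      hfc.stronglyMeasurable.stronglyMeasurableAtFilter hfc.continuousAt
  have hgz : ∀ t, 0 ≤ t → g t = 0 := by
    intro t ht
    rw [hg]
    simp only
    rw [intervalIntegral.integral_symm, intervalIntegral.integral_congr (g := fun _ => 0)]
    · simp
    · intro s hs
      rw [Set.uIcc_of_le ht] at hs
      exact hfz s hs.1
  have hg0 : ∀ t, 0 ≤ g t := by
    intro t
    rcases le_total 0 t with h | h
    · rw [hgz t h]
    · exact intervalIntegral.integral_nonneg h fun s _ => hf0 s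
  refine ⟨g, fun t => -f t, ?_, hgd, ?_, ?_, hg0, ?_⟩
  · rw [contDiff_infty_iff_deriv]
    refine ⟨fun t => (hgd t).differentiableAt, ?_⟩
    have : deriv g = fun t => -f t := funext fun t => (hgd t).deriv
    rw [this]; exact hfs.neg
  · intro t; rw [abs_neg, abs_of_nonneg (hf0 t)]; exact hf1 t
  · intro t ht; exact ⟨hgz t ht, by simp [hfz t ht]⟩
  · intro t
    rcases le_total t (-δ) with h | h
    · have h1 : g t = (∫ s in t..(-δ), f s) + g (-δ) :=
        (intervalIntegral.integral_add_adjacent_intervals (hfc.intervalIntegrable _ _)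
          (hfc.intervalIntegrable _ _)).symm
      have h2 : ∫ s in t..(-δ), f s = ∫ s in t..(-δ), (1:ℝ) := by
        refine intervalIntegral.integral_congr fun s hs => ?_
        rw [Set.uIcc_of_le h] at hs
        exact hfo s hs.2
      rw [h1, h2]
      simp only [intervalIntegral.integral_const, smul_eq_mul, mul_one]
      have := hg0 (-δ)
      linarith
    · have := hg0 t; linarith

lemma beta_int {c : ℝ} (d : ℕ) :
    ∫ s in (0:ℝ)..c, (c - s) ^ d * s = c ^ (d + 2) / ((d + 1) * (d + 2)) := by
  have hd : ∀ s ∈ Set.uIcc 0 c, HasDerivAt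
      (fun s : ℝ => (c - s) ^ (d + 2) / (d + 2) - c * (c - s) ^ (d + 1) / (d + 1)) ((c - s) ^ d * s) s := by
    intro s _
    have h0 : HasDerivAt (fun s : ℝ => c - s) (-1) s := by simpa using (hasDerivAt_id s).const_sub c
    have h1 := ((h0.pow (d + 2)).div_const ((d : ℝ) + 2)).sub (((h0.pow (d + 1)).const_mul c).div_const ((d : ℝ) + 1))
    refine HasDerivAt.congr_deriv h1 ?_
    have e1 : d + 2 - 1 = d + 1 := by omega
    have e2 : d + 1 - 1 = d := by omega
    rw [e1, e2]
    push_cast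
    field_simp
    ring
  rw [intervalIntegral.integral_eq_sub_of_hasDerivAt hd (by
    apply Continuous.intervalIntegrable; fun_prop)]
  simp
  field_simp
  ring

lemma cone_meas {d : ℕ} {S : Set (Euc d)} (hS : Convex ℝ S) {A w : Euc d} (hA : A ∈ S)
    (hw : ∀ x ∈ S, inner ℝ w (x - A) < 1) {l : ℝ} (h0 : 0 < l) (h1 : l ≤ 1) :
    ENNReal.ofReal (l ^ d) * volume S ≤ volume (S ∩ {x | inner ℝ w (x - A) < l}) := by
  have := Measure.addHaar_image_homothety (volume : Measure (Euc d)) A l S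
  rw [finrank_euclideanSpace_fin, abs_of_nonneg (by positivity)] at this
  rw [← this]
  apply measure_mono
  rintro _ ⟨x, hx, rfl⟩
  rw [AffineMap.homothety_apply]
  simp only [vsub_eq_sub, vadd_eq_add]
  constructor
  · have := hS hx hA h0.le (sub_nonneg.2 h1) (by ring)
    convert this using 1
    module
  · show inner ℝ w (l • (x - A) + A - A) < l
    rw [add_sub_cancel_right, inner_smul_right]
    have := hw x hx
    nlinarith

lemma cone_int {d : ℕ} {S : Set (Euc d)} (hS : Convex ℝ S) (hb : Bornology.IsBounded S)
    {A w : Euc d} (hA : A ∈ S)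
    (hw : ∀ x ∈ S, inner ℝ w (x - A) < 1) {c : ℝ} (hc0 : 0 < c) (hc1 : c ≤ 1) :
    2 * (c ^ (d + 2) / ((d + 1) * (d + 2))) * volume.real S ≤
      ∫ x in S, (max (c - inner ℝ w (x - A)) 0) ^ 2 := by
  set f : Euc d → ℝ := fun x => max (c - inner ℝ w (x - A)) 0 with hf
  have hfc : Continuous f := by fun_prop
  have hlay := lintegral_rpow_eq_lintegral_meas_lt_mul (volume.restrict S) (f := f)
    (Eventually.of_forall fun x => le_max_right _ _) hfc.aemeasurable (p := 2) (by norm_num)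
  have hfin : volume S ≠ ⊤ := hb.measure_lt_top.ne
  have e1 : ∫⁻ x in S, ENNReal.ofReal (f x ^ (2:ℝ)) = ENNReal.ofReal (∫ x in S, f x ^ 2) := by
    rw [ofReal_integral_eq_lintegral_ofReal (int_bdd hb (by fun_prop)) (Eventually.of_forall fun x => sq_nonneg _)]
    simp only [Real.rpow_two]
  have e2 : ENNReal.ofReal (c ^ (d + 2) / ((d + 1) * (d + 2))) * volume S ≤
      ∫⁻ (t : ℝ) in Set.Ioi 0, (volume.restrict S) {a | t < f a} * ENNReal.ofReal (t ^ ((2:ℝ) - 1)) := by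
    have hci : IntegrableOn (fun s => (c - s) ^ d * s) (Set.Ioc 0 c) := by
      have : IntervalIntegrable (fun s => (c - s) ^ d * s) volume 0 c := by
        apply Continuous.intervalIntegrable; fun_prop
      rwa [intervalIntegrable_iff_integrableOn_Ioc_of_le hc0.le] at this
    rw [← beta_int, intervalIntegral.integral_of_le hc0.le, integral_Ioc_eq_integral_Ioo,
      ofReal_integral_eq_lintegral_ofReal (hci.mono_set Set.Ioo_subset_Ioc_self)
        ((ae_restrict_mem measurableSet_Ioo).mono fun s hs => by
          have h1 : 0 ≤ c - s := by linarith [hs.2]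
          have h2 := hs.1.le
          show 0 ≤ (c - s) ^ d * s
          positivity), ← lintegral_mul_const' _ _ hfin]
    refine le_trans ?_ (lintegral_mono_set (s := Set.Ioo 0 c) Set.Ioo_subset_Ioi_self)
    refine setLIntegral_mono' measurableSet_Ioo fun s hs => ?_
    have h1 : 0 < c - s := by linarith [hs.2]
    have := cone_meas hS hA hw h1 (by linarith [hs.1])
    rw [Measure.restrict_apply (isOpen_lt continuous_const hfc).measurableSet]
    have e3 : (2:ℝ) - 1 = 1 := by norm_num
    rw [e3, Real.rpow_one, ENNReal.ofReal_mul (by positivity), mul_right_comm]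
    gcongr
    refine this.trans (measure_mono ?_)
    rintro x ⟨hx1, hx2⟩
    refine ⟨?_, hx1⟩
    have hx2' : inner ℝ w (x - A) < c - s := hx2
    show s < max (c - inner ℝ w (x - A)) 0
    exact lt_max_of_lt_left (by linarith)
  rw [e1] at hlay
  have hpos : 0 ≤ c ^ (d + 2) / (((d:ℝ) + 1) * (d + 2)) := by positivity
  have h3 : ENNReal.ofReal (2 * (c ^ (d + 2) / ((d + 1) * (d + 2))) * volume.real S) ≤ ENNReal.ofReal (∫ x in S, f x ^ 2) := by
    rw [hlay, ENNReal.ofReal_mul (by positivity), ENNReal.ofReal_mul (by norm_num), mul_assoc, Measure.real,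
      ENNReal.ofReal_toReal hfin]
    gcongr
  rwa [ENNReal.ofReal_le_ofReal_iff (integral_nonneg fun x => sq_nonneg _)] at h3

lemma side_fun {d : ℕ} {Ω : Set (Euc d)} (h : IsConvexDomain Ω) {A : Euc d} (hA : A ∈ Ω) (w : Euc d)
    {c : ℝ} (hc0 : 0 < c) (hc1 : c < 1) : ∃ φ : Euc d → ℝ, ContDiff ℝ (⊤ : ℕ∞) φ ∧
      (∀ x, 1 ≤ inner ℝ w (x - A) → φ x = 0 ∧ fderiv ℝ φ x = 0) ∧ φ A ≠ 0 ∧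
      2 * (c ^ (d + 2) / ((d + 1) * (d + 2))) * (∫ x in Ω, ‖fderiv ℝ φ x‖ ^ 2) ≤
        ‖w‖ ^ 2 * ∫ x in Ω, φ x ^ 2 := by
  obtain ⟨hne, ho, hb, hconv⟩ := h
  obtain ⟨g, g', hgs, hgd, hg1, hgz, hg0, hgl⟩ := smooth_ramp (sub_pos.2 hc1)
  set φ : Euc d → ℝ := fun x => g (inner ℝ w (x - A) - 1) with hφ
  have hφs : ContDiff ℝ (⊤ : ℕ∞) φ := hgs.comp
    ((contDiff_const.inner ℝ (contDiff_id.sub contDiff_const)).sub contDiff_const)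
  have hφc : Continuous φ := hφs.continuous
  have hφd : ∀ x, fderiv ℝ φ x = g' (inner ℝ w (x - A) - 1) • (innerSL ℝ w) := by
    intro x
    have h1 : HasFDerivAt (fun x : Euc d => inner ℝ w (x - A) - 1) (innerSL ℝ w) x := by
      have : (fun x : Euc d => inner ℝ w (x - A) - 1) = fun x => innerSL ℝ w x - (inner ℝ w A + 1) := by
        funext x; simp [inner_sub_right]; ring
      rw [this]
      exact (innerSL ℝ w).hasFDerivAt.sub_const _
    exact ((hgd _).comp_hasFDerivAt x h1).fderiv
  have hz : ∀ x, 1 ≤ inner ℝ w (x - A) → φ x = 0 ∧ fderiv ℝ φ x = 0 := by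
    intro x hx
    have := hgz (inner ℝ w (x - A) - 1) (by linarith)
    exact ⟨this.1, by rw [hφd, this.2, zero_smul]⟩
  set H : Set (Euc d) := {x | inner ℝ w (x - A) < 1} with hH
  have hHo : IsOpen H := isOpen_lt (by fun_prop) continuous_const
  have hHc : Convex ℝ H := by
    intro x hx y hy a b ha hb hab
    simp only [hH, Set.mem_ofPred_eq, inner_sub_right] at hx hy ⊢
    rw [inner_add_right, inner_smul_right, inner_smul_right]
    have : inner ℝ w A = a * inner ℝ w A + b * inner ℝ w A := by rw [← add_mul, hab, one_mul]
    have key : a * (inner ℝ w x - inner ℝ w A) + b * (inner ℝ w y - inner ℝ w A) < 1 := by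
      rcases ha.eq_or_lt with h0 | h0
      · have : b = 1 := by linarith
        rw [← h0, this]; linarith
      · have h1 := mul_lt_mul_of_pos_left hx h0
        have h2 := mul_le_mul_of_nonneg_left hy.le hb
        linarith
    linarith
  set S := Ω ∩ H with hS
  have hSo : IsOpen S := ho.inter hHo
  have hSb : Bornology.IsBounded S := hb.subset Set.inter_subset_left
  have hAS : A ∈ S := ⟨hA, by simp [hH]⟩
  have hcone := cone_int (hconv.inter hHc) hSb hAS (fun x hx => hx.2) hc0 hc1.le
  refine ⟨φ, hφs, hz, ?_, ?_⟩
  · have := hgl (-1)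
    have e : φ A = g (-1) := by simp [hφ]
    rw [e]; apply ne_of_gt; linarith
  · have hfc : Continuous (fderiv ℝ φ) := hφs.continuous_fderiv (by simp)
    have r1 : ∫ x in Ω, ‖fderiv ℝ φ x‖ ^ 2 = ∫ x in S, ‖fderiv ℝ φ x‖ ^ 2 :=
      setIntegral_eq_of_subset_of_forall_sdiff_eq_zero ho.measurableSet Set.inter_subset_left fun x hx => by
        have : 1 ≤ inner ℝ w (x - A) := by
          by_contra hcon; exact hx.2 ⟨hx.1, not_le.1 hcon⟩
        simp [(hz x this).2]
    have r2 : ∫ x in S, ‖fderiv ℝ φ x‖ ^ 2 ≤ ‖w‖ ^ 2 * volume.real S := by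
      have : ∫ x in S, (‖w‖ ^ 2 : ℝ) = ‖w‖ ^ 2 * volume.real S := by simp [mul_comm]
      rw [← this]
      refine setIntegral_mono_on (int_bdd hSb (by fun_prop)) (int_bdd hSb (by fun_prop)) hSo.measurableSet fun x hx => ?_
      rw [hφd, norm_smul, innerSL_apply_norm, Real.norm_eq_abs]
      have := hg1 (inner ℝ w (x - A) - 1)
      gcongr
      exact mul_le_of_le_one_left (norm_nonneg _) this
    have r3 : ∫ x in S, (max (c - inner ℝ w (x - A)) 0) ^ 2 ≤ ∫ x in S, φ x ^ 2 := by
      refine setIntegral_mono_on (int_bdd hSb (by fun_prop)) (int_bdd hSb (by fun_prop)) hSo.measurableSet fun x hx => ?_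
      have h1 := hgl (inner ℝ w (x - A) - 1)
      have h2 := hg0 (inner ℝ w (x - A) - 1)
      have h3 : max (c - inner ℝ w (x - A)) 0 ≤ φ x := max_le (by simp only [hφ]; linarith) h2
      have h4 : 0 ≤ max (c - inner ℝ w (x - A)) 0 := le_max_right _ _
      gcongr
    have r4 : ∫ x in S, φ x ^ 2 ≤ ∫ x in Ω, φ x ^ 2 :=
      setIntegral_mono_set (int_bdd hb (by fun_prop)) (Eventually.of_forall fun x => sq_nonneg _)
        (LE.le.eventuallyLE (Set.inter_subset_left))
    have r5 := hcone.trans (r3.trans r4)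
    rw [r1]
    calc _ ≤ 2 * (c ^ (d + 2) / (((d:ℝ) + 1) * (d + 2))) * (‖w‖ ^ 2 * volume.real S) := by gcongr
      _ = ‖w‖ ^ 2 * (2 * (c ^ (d + 2) / (((d:ℝ) + 1) * (d + 2))) * volume.real S) := by ring
      _ ≤ _ := by gcongr

end Part8

lemma eigen_set_bddBelow {d : ℕ} (k : ℕ) (Ω : Set (Euc d)) : BddBelow { t : ℝ | ∃ V : Submodule ℝ (Euc d → ℝ),
    (∀ u ∈ V, ContDiff ℝ (⊤ : ℕ∞) u) ∧
    Module.finrank ℝ (V.map (LinearMap.funLeft ℝ ℝ ((↑) : Ω → Euc d))) = k + 1 ∧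
    t = sSup { r : ℝ | ∃ u ∈ V, (0 < ∫ x in Ω, (u x) ^ 2) ∧ r = rayleigh Ω u } } := by
  refine ⟨0, ?_⟩
  rintro t ⟨V, _, _, rfl⟩
  apply Real.sSup_nonneg
  rintro r ⟨u, _, _, rfl⟩
  exact rayleigh_nonneg _ _

lemma test_space {d : ℕ} {Ω : Set (Euc d)} (h : IsConvexDomain Ω) {A B : Euc d} (hA : A ∈ Ω) (hB : B ∈ Ω)
    (hAB : A ≠ B) {c : ℝ} (hc0 : 0 < c) (hc1 : c < 1) :
    ∃ V : Submodule ℝ (Euc d → ℝ), (∀ u ∈ V, ContDiff ℝ (⊤ : ℕ∞) u) ∧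
    Module.finrank ℝ (V.map (LinearMap.funLeft ℝ ℝ ((↑) : Ω → Euc d))) = 1 + 1 ∧
    sSup { r : ℝ | ∃ u ∈ V, (0 < ∫ x in Ω, (u x) ^ 2) ∧ r = rayleigh Ω u } * (c ^ (d + 2) * ‖B - A‖ ^ 2) ≤
      2 * (d + 1) * (d + 2) := by
  have hn : 0 < ‖B - A‖ := norm_pos_iff.2 (sub_ne_zero.2 hAB.symm)
  set w : Euc d := (2 / ‖B - A‖ ^ 2) • (B - A) with hw
  have hwn : ‖w‖ ^ 2 = 4 / ‖B - A‖ ^ 2 := by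
    rw [hw, norm_smul, Real.norm_of_nonneg (by positivity)]; field_simp; norm_num
  have hwBA : inner ℝ w (B - A) = 2 := by
    rw [hw, inner_smul_left, real_inner_self_eq_norm_sq]; simp; field_simp
  obtain ⟨φ, hφs, hφz, hφA, hφi⟩ := side_fun h hA w hc0 hc1
  obtain ⟨ψ, hψs, hψz, hψB, hψi⟩ := side_fun h hB (-w) hc0 hc1
  rw [norm_neg] at hψi
  obtain ⟨hne, ho, hb, hconv⟩ := h
  have hrel : ∀ x, inner ℝ (-w) (x - B) = 2 - inner ℝ w (x - A) := by
    intro x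
    have : x - B = (x - A) - (B - A) := by abel
    rw [this, inner_neg_left, inner_sub_right, hwBA]; ring
  have hdisj : ∀ x, (φ x = 0 ∧ fderiv ℝ φ x = 0) ∨ (ψ x = 0 ∧ fderiv ℝ ψ x = 0) := by
    intro x
    rcases le_total 1 (inner ℝ w (x - A)) with h1 | h1
    · exact Or.inl (hφz x h1)
    · exact Or.inr (hψz x (by rw [hrel]; linarith))
  have hφB : φ B = 0 := (hφz B (by rw [hwBA]; norm_num)).1
  have hψA : ψ A = 0 := (hψz A (by rw [hrel]; simp)).1
  have hφc := hφs.continuous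
  have hψc := hψs.continuous
  have dφ : Continuous (fderiv ℝ φ) := hφs.continuous_fderiv (by simp)
  have dψ : Continuous (fderiv ℝ ψ) := hψs.continuous_fderiv (by simp)
  refine ⟨Submodule.span ℝ (Set.range ![φ, ψ]), ?_, ?_, ?_⟩
  · intro u hu
    rw [Matrix.range_cons, Matrix.range_cons, Matrix.range_empty, Set.union_empty] at hu
    obtain ⟨α, β, rfl⟩ := Submodule.mem_span_pair.1 hu
    exact (hφs.const_smul α).add (hψs.const_smul β)
  · rw [Submodule.map_span, ← Set.range_comp, finrank_span_eq_card]
    · simp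
    · have e : (LinearMap.funLeft ℝ ℝ ((↑) : Ω → Euc d)) ∘ ![φ, ψ] =
          ![LinearMap.funLeft ℝ ℝ ((↑) : Ω → Euc d) φ, LinearMap.funLeft ℝ ℝ ((↑) : Ω → Euc d) ψ] := by
        funext i; fin_cases i <;> rfl
      rw [e, LinearIndependent.pair_iff]
      intro s t hst
      have h1 := congrFun hst ⟨A, hA⟩
      have h2 := congrFun hst ⟨B, hB⟩
      simp only [Pi.add_apply, Pi.smul_apply, LinearMap.funLeft_apply, smul_eq_mul, hψA, hφB,
        mul_zero, add_zero, zero_add, Pi.zero_apply, mul_eq_zero, hφA, hψB, or_false] at h1 h2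
      exact ⟨h1, h2⟩
  · have hcd : 0 < c ^ (d + 2) := by positivity
    rw [← le_div_iff₀ (by positivity)]
    refine Real.sSup_le ?_ (by positivity)
    rintro r ⟨u, hu, hup, rfl⟩
    rw [Matrix.range_cons, Matrix.range_cons, Matrix.range_empty, Set.union_empty] at hu
    obtain ⟨α, β, rfl⟩ := Submodule.mem_span_pair.1 hu
    have hden : ∫ x in Ω, (α • φ + β • ψ) x ^ 2 = α ^ 2 * (∫ x in Ω, φ x ^ 2) + β ^ 2 * ∫ x in Ω, ψ x ^ 2 := by
      rw [← integral_const_mul, ← integral_const_mul,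
        ← integral_add (int_bdd hb (by fun_prop)) (int_bdd hb (by fun_prop))]
      congr 1
      funext x
      simp only [Pi.add_apply, Pi.smul_apply, smul_eq_mul]
      rcases hdisj x with h1 | h1 <;> rw [h1.1] <;> ring
    have hnum : ∫ x in Ω, ‖fderiv ℝ (α • φ + β • ψ) x‖ ^ 2 =
        α ^ 2 * (∫ x in Ω, ‖fderiv ℝ φ x‖ ^ 2) + β ^ 2 * ∫ x in Ω, ‖fderiv ℝ ψ x‖ ^ 2 := by
      rw [← integral_const_mul, ← integral_const_mul,
        ← integral_add (int_bdd hb (by fun_prop)) (int_bdd hb (by fun_prop))]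
      congr 1
      funext x
      have hf : fderiv ℝ (α • φ + β • ψ) x = α • fderiv ℝ φ x + β • fderiv ℝ ψ x :=
        (((hφs.differentiable (by simp) x).hasFDerivAt.const_smul α).add
          ((hψs.differentiable (by simp) x).hasFDerivAt.const_smul β)).fderiv
      rw [hf]
      rcases hdisj x with h1 | h1 <;> rw [h1.2] <;> simp [norm_smul, mul_pow]
    unfold rayleigh
    rw [div_le_div_iff₀ hup (by positivity), hnum, hden]
    rw [hwn] at hφi hψi
    have conv : ∀ N P : ℝ, 2 * (c ^ (d + 2) / (((d:ℝ) + 1) * (d + 2))) * N ≤ 4 / ‖B - A‖ ^ 2 * P →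
        N * (c ^ (d + 2) * ‖B - A‖ ^ 2) ≤ 2 * (d + 1) * (d + 2) * P := by
      intro N P hNP
      have := mul_le_mul_of_nonneg_left hNP (show 0 ≤ (((d:ℝ) + 1) * (d + 2)) * ‖B - A‖ ^ 2 by positivity)
      field_simp at this
      nlinarith
    have k1 := mul_le_mul_of_nonneg_left (conv _ _ hφi) (sq_nonneg α)
    have k2 := mul_le_mul_of_nonneg_left (conv _ _ hψi) (sq_nonneg β)
    linarith

lemma eigen_upper {d : ℕ} {Ω : Set (Euc d)} (h : IsConvexDomain Ω) {A B : Euc d} (hA : A ∈ Ω) (hB : B ∈ Ω) :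
    neumannEigenvalue 1 Ω * ‖B - A‖ ^ 2 ≤ 2 * (d + 1) * (d + 2) := by
  by_cases hAB : A = B
  · subst hAB; simp; positivity
  have hc : ∀ c ∈ Set.Ioo (0:ℝ) 1, neumannEigenvalue 1 Ω * (c ^ (d + 2) * ‖B - A‖ ^ 2) ≤ 2 * (d + 1) * (d + 2) := by
    intro c hc
    obtain ⟨V, h1, h2, h3⟩ := test_space h hA hB hAB hc.1 hc.2
    refine le_trans ?_ h3
    have h0 := hc.1.le
    refine mul_le_mul_of_nonneg_right ?_ (by positivity)
    exact csInf_le (eigen_set_bddBelow 1 Ω) ⟨V, h1, h2, rfl⟩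
  have hcont : Continuous fun c : ℝ => neumannEigenvalue 1 Ω * (c ^ (d + 2) * ‖B - A‖ ^ 2) := by fun_prop
  have ht : Tendsto (fun c : ℝ => neumannEigenvalue 1 Ω * (c ^ (d + 2) * ‖B - A‖ ^ 2)) (nhdsWithin 1 (Set.Iio 1))
      (nhds (neumannEigenvalue 1 Ω * ((1:ℝ) ^ (d + 2) * ‖B - A‖ ^ 2))) := (hcont.tendsto 1).mono_left nhdsWithin_le_nhds
  have := le_of_tendsto ht (b := 2 * ((d:ℝ) + 1) * (d + 2)) (by
    filter_upwards [Ioo_mem_nhdsLT (show (0:ℝ) < 1 by norm_num)] with c hcc using hc c hcc)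
  simpa using this

lemma two_points {d : ℕ} (hd : 0 < d) {Ω : Set (Euc d)} (h : IsConvexDomain Ω) : ∃ A ∈ Ω, ∃ B ∈ Ω, A ≠ B := by
  obtain ⟨⟨A, hA⟩, ho, _, _⟩ := h
  obtain ⟨ε, hε, hball⟩ := Metric.isOpen_iff.1 ho A hA
  refine ⟨A, hA, A + EuclideanSpace.single ⟨0, hd⟩ (ε / 2), hball ?_, ?_⟩
  · rw [Metric.mem_ball, dist_eq_norm, add_sub_cancel_left, EuclideanSpace.norm_single,
      Real.norm_of_nonneg (by positivity)]
    linarith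
  · intro h
    have h2 : (EuclideanSpace.single (⟨0, hd⟩ : Fin d) (ε / 2) : Euc d) = 0 := by
      simpa using h.symm
    have := congrArg norm h2
    rw [EuclideanSpace.norm_single, Real.norm_of_nonneg (by positivity), norm_zero] at this
    linarith

lemma eigen_lower {m : ℕ} {Ω : Set (Euc (m+1))} (h : IsConvexDomain Ω) {k : ℝ} (hk : 0 < k)
    (hkD : k * Metric.diam Ω ≤ π) : k ^ 2 ≤ neumannEigenvalue 1 Ω := by
  obtain ⟨A, hA, B, hB, hAB⟩ := two_points (Nat.succ_pos m) h
  obtain ⟨V, h1, h2, _⟩ := test_space h hA hB hAB (c := 1/2) (by norm_num) (by norm_num)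
  refine le_csInf ⟨_, V, h1, h2, rfl⟩ ?_
  rintro t ⟨V, hV, hr, rfl⟩
  exact rayleigh_sup_ge h hk hkD V hV hr

lemma eigen_nonneg {d : ℕ} (k : ℕ) (Ω : Set (Euc d)) : 0 ≤ neumannEigenvalue k Ω := by
  apply Real.sInf_nonneg
  rintro t ⟨V, _, _, rfl⟩
  apply Real.sSup_nonneg
  rintro r ⟨u, _, _, rfl⟩
  exact rayleigh_nonneg _ _

/-- the non-sharp quasi-monotonicity of the first nontrivial Neumann eigenvalue
with constant `π²/(2d(d+4))`. -/
theorem first_eigenvalue_quasi_monotonicity_simple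
    (d : ℕ) (hd : 2 ≤ d) (Ω₁ Ω₂ : Set (Euc d))
    (h₁ : IsConvexDomain Ω₁) (h₂ : IsConvexDomain Ω₂) (hsub : Ω₁ ⊆ Ω₂) :
    neumannEigenvalue 1 Ω₁ ≥
      Real.pi ^ 2 / (2 * (d : ℝ) * ((d : ℝ) + 4)) * neumannEigenvalue 1 Ω₂ := by
  obtain ⟨m, rfl⟩ : ∃ m, d = m + 1 := ⟨d - 1, by omega⟩
  set n : ℝ := ((m + 1 : ℕ) : ℝ) with hn
  have hn2 : 2 ≤ n := by rw [hn]; exact_mod_cast hd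
  obtain ⟨A, hA, B, hB, hAB⟩ := two_points (Nat.succ_pos m) h₂
  set D := Metric.diam Ω₂ with hD
  have hDpos : 0 < D := lt_of_lt_of_le (dist_pos.2 hAB) (Metric.dist_le_diam_of_mem h₂.2.2.1 hA hB)
  have hlow : (π / D) ^ 2 ≤ neumannEigenvalue 1 Ω₁ := by
    refine eigen_lower h₁ (by positivity) ?_
    rw [div_mul_eq_mul_div, div_le_iff₀ hDpos]
    exact mul_le_mul_of_nonneg_left (Metric.diam_mono hsub h₂.2.2.1) pi_pos.le
  have hμ := eigen_nonneg 1 Ω₂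
  set μ := neumannEigenvalue 1 Ω₂ with hμd
  have hup : μ * D ^ 2 ≤ 2 * (n + 1) * (n + 2) := by
    rcases hμ.eq_or_lt with h0 | h0
    · rw [← h0]; simp; positivity
    · have hK : 0 ≤ 2 * (n + 1) * (n + 2) / μ := by positivity
      have : D ≤ √(2 * (n + 1) * (n + 2) / μ) := by
        refine Metric.diam_le_of_forall_dist_le (Real.sqrt_nonneg _) fun x hx y hy => ?_
        apply Real.le_sqrt_of_sq_le
        rw [le_div_iff₀ h0, mul_comm, dist_eq_norm]
        exact eigen_upper h₂ hy hx
      have h2 : D ^ 2 ≤ 2 * (n + 1) * (n + 2) / μ := by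
        rw [← Real.sq_sqrt hK]; gcongr
      rw [le_div_iff₀ h0] at h2
      linarith
  refine ge_iff_le.2 (le_trans ?_ hlow)
  rw [div_pow, div_mul_eq_mul_div, div_le_div_iff₀ (by positivity) (by positivity), mul_assoc]
  have : μ * D ^ 2 ≤ 2 * n * (n + 4) := by nlinarith
  exact mul_le_mul_of_nonneg_left this (by positivity)

end
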